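/- arXiv:1906.09377 — 6 statements merged into one kernel-verified Lean document; each statement's English description precedes it below -/
import Mathlib

section
/- Let (X_i)_{i≥1} be i.i.d. random variables with mean 0, variance 1, and E|X_1|^p < ∞ for some p > 2. Let X̄_i := (X_1 + ... + X_i)/i and M_n := sup{X̄_i : i ≥ n}. Then, almost surely, limsup_{n→∞} (√n / √(2 log log n)) · M_n = 1. -/
open MeasureTheory ProbabilityTheory Real Filter
open scoped ENNReal


theorem lil_meas_biInter {Ω ι κ : Type*} {mΩ : MeasurableSpace Ω} {μ : Measure Ω}
    {m : ι → MeasurableSpace Ω} (h_le : ∀ i, m i ≤ mΩ) (h : iIndep m μ)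
    (T : κ → Set ι) (hT : Pairwise (fun a b => Disjoint (T a) (T b)))
    (E : κ → Set Ω) (hE : ∀ k, MeasurableSet[⨆ i ∈ T k, m i] (E k)) (s : Finset κ) :
    μ (⋂ k ∈ s, E k) = ∏ k ∈ s, μ (E k) := by
  classical
  have := h.isProbabilityMeasure
  induction s using Finset.induction_on with
  | empty => simp
  | insert a s ha ih =>
    rw [Finset.prod_insert ha, ← ih, Finset.set_biInter_insert]
    have hd : Disjoint (T a) (⋃ k ∈ s, T k) := by
      simp only [Set.disjoint_iUnion_right]
      intro k hk
      exact hT (fun h => ha (h ▸ hk))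
    have hi := indep_iSup_of_disjoint h_le h hd
    rw [Indep_iff] at hi
    refine hi _ _ (hE a) ?_
    refine Finset.measurableSet_biInter s fun k hk => ?_
    refine (iSup₂_le fun i hi => ?_ : (⨆ i ∈ T k, m i) ≤ _) _ (hE k)
    exact le_iSup₂_of_le i (Set.mem_biUnion hk hi) le_rfl

open Classical in
noncomputable def lilZ {Ω : Type*} (a : ℝ≥0∞) (ξ : ℕ → Ω → ℝ≥0∞) : ℕ → Ω → ℝ≥0∞
  | 0 => fun _ => 1
  | (n+1) => fun ω => if a ≤ lilZ a ξ n ω then lilZ a ξ n ω else lilZ a ξ n ω * ξ n ω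

theorem lilZ_meas {Ω : Type*} (a : ℝ≥0∞) (ξ : ℕ → Ω → ℝ≥0∞) (n : ℕ) (m : MeasurableSpace Ω)
    (hm : ∀ j < n, Measurable[m] (ξ j)) : Measurable[m] (lilZ a ξ n) := by
  induction n with
  | zero => exact measurable_const
  | succ n ih =>
    have h1 := ih (fun j hj => hm j (by omega))
    have h2 := hm n (by omega)
    have : lilZ a ξ (n+1) = fun ω => if a ≤ lilZ a ξ n ω then lilZ a ξ n ω else lilZ a ξ n ω * ξ n ω := rfl
    rw [this]
    exact Measurable.ite (measurableSet_le measurable_const h1) h1 (h1.mul h2)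

theorem lilZ_lint {Ω : Type*} {mΩ : MeasurableSpace Ω} {μ : Measure Ω} (a : ℝ≥0∞)
    (ξ : ℕ → Ω → ℝ≥0∞) (hξ : ∀ i, Measurable (ξ i)) (hi : iIndepFun ξ μ)
    (h1 : ∀ i, ∫⁻ ω, ξ i ω ∂μ ≤ 1) (n : ℕ) : ∫⁻ ω, lilZ a ξ n ω ∂μ ≤ 1 := by
  classical
  have := hi.isProbabilityMeasure
  induction n with
  | zero => simp [lilZ]
  | succ n ih =>
    refine le_trans ?_ ih
    have hle : ∀ i, MeasurableSpace.comap (ξ i) inferInstance ≤ mΩ := fun i => (hξ i).comap_le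
    have hind := indep_iSup_of_disjoint hle hi.iIndep (S := Set.Iio n) (T := {n}) (by simp)
    simp only [Set.mem_singleton_iff, iSup_iSup_eq_left] at hind
    set m' := ⨆ i ∈ Set.Iio n, MeasurableSpace.comap (ξ i) inferInstance with hm'
    have hm'le : m' ≤ mΩ := iSup₂_le fun i _ => hle i
    have hZ' : Measurable[m'] (lilZ a ξ n) := lilZ_meas a ξ n m' fun j hj => by
      refine Measurable.mono (comap_measurable (ξ j)) ?_ le_rfl
      exact le_iSup₂_of_le (f := fun i (_ : i ∈ Set.Iio n) => MeasurableSpace.comap (ξ i) inferInstance) j hj le_rfl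
    have hZ : Measurable[mΩ] (lilZ a ξ n) := lilZ_meas a ξ n mΩ (fun j _ => hξ j)
    have hs : MeasurableSet[mΩ] {ω | a ≤ lilZ a ξ n ω} := hZ measurableSet_Ici
    have hs' : MeasurableSet[m'] {ω | a ≤ lilZ a ξ n ω} := hZ' measurableSet_Ici
    set s := {ω | a ≤ lilZ a ξ n ω} with hsdef
    have e1 : ∀ ω, lilZ a ξ (n+1) ω = s.indicator (lilZ a ξ n) ω + sᶜ.indicator (lilZ a ξ n) ω * ξ n ω := by
      intro ω
      have : lilZ a ξ (n+1) ω = if a ≤ lilZ a ξ n ω then lilZ a ξ n ω else lilZ a ξ n ω * ξ n ω := rfl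
      rw [this]
      by_cases h : a ≤ lilZ a ξ n ω
      · simp [hsdef, h]
      · simp [hsdef, h]
    have e2 : ∀ ω, lilZ a ξ n ω = s.indicator (lilZ a ξ n) ω + sᶜ.indicator (lilZ a ξ n) ω := by
      intro ω
      by_cases h : a ≤ lilZ a ξ n ω
      · simp [hsdef, h]
      · simp [hsdef, h]
    simp_rw [e1]
    rw [lintegral_congr e2]
    rw [lintegral_add_left (hZ.indicator hs), lintegral_add_left (hZ.indicator hs)]
    refine add_le_add le_rfl ?_
    rw [lintegral_mul_eq_lintegral_mul_lintegral_of_independent_measurableSpace hm'le (hle n) hind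
      (hZ'.indicator hs'.compl) (comap_measurable _)]
    exact mul_le_of_le_one_right' (h1 n)

theorem lilZ_stop {Ω : Type*} (a : ℝ≥0∞) (ξ : ℕ → Ω → ℝ≥0∞) (ω : Ω) (n : ℕ) :
    (∃ i ≤ n, a ≤ ∏ j ∈ Finset.range i, ξ j ω) → a ≤ lilZ a ξ n ω := by
  have key : ∀ n, a ≤ lilZ a ξ n ω ∨ lilZ a ξ n ω = ∏ j ∈ Finset.range n, ξ j ω := by
    intro n
    induction n with
    | zero => right; simp [lilZ]
    | succ n ih =>
      have : lilZ a ξ (n+1) ω = if a ≤ lilZ a ξ n ω then lilZ a ξ n ω else lilZ a ξ n ω * ξ n ω := rfl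
      rw [this, Finset.prod_range_succ]
      by_cases h : a ≤ lilZ a ξ n ω
      · left; simp [h]
      · right
        rw [if_neg h, ih.resolve_left h]
  rintro ⟨i, hi, h⟩
  have hi0 : a ≤ lilZ a ξ i ω := by
    rcases key i with h' | h'
    · exact h'
    · rwa [h']
  induction n, hi using Nat.le_induction with
  | base => exact hi0
  | succ n _ ih =>
    have : lilZ a ξ (n+1) ω = if a ≤ lilZ a ξ n ω then lilZ a ξ n ω else lilZ a ξ n ω * ξ n ω := rfl
    rw [this, if_pos ih]; exact ih

theorem lil_ville {Ω : Type*} {mΩ : MeasurableSpace Ω} {μ : Measure Ω} (a : ℝ≥0∞)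
    (ξ : ℕ → Ω → ℝ≥0∞) (hξ : ∀ i, Measurable (ξ i)) (hi : iIndepFun ξ μ)
    (h1 : ∀ i, ∫⁻ ω, ξ i ω ∂μ ≤ 1) (n : ℕ) :
    μ {ω | ∃ i ≤ n, a ≤ ∏ j ∈ Finset.range i, ξ j ω} ≤ a⁻¹ := by
  have h := mul_meas_ge_le_lintegral (μ := μ) (lilZ_meas a ξ n mΩ (fun j _ => hξ j)) a
  have h2 := h.trans (lilZ_lint a ξ hξ hi h1 n)
  rw [ENNReal.le_inv_iff_mul_le, mul_comm]
  refine le_trans ?_ h2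
  gcongr
  exact fun hh => lilZ_stop a ξ _ n hh

theorem lil_exp_bound {η u : ℝ} (hη : η ≤ 1) (hη0 : 0 ≤ η) (hu : u ≤ η) :
    Real.exp u ≤ 1 + u + (1 + η) * u ^ 2 / 2 := by
  rcases le_or_gt u 0 with h0 | h0
  · -- negative case
    have h : ∀ v : ℝ, 0 ≤ v → Real.exp (-v) ≤ 1 - v + v^2/2 := by
      intro v hv
      have h1 : 1 + v + v^2/2 ≤ Real.exp v := Real.quadratic_le_exp_of_nonneg hv
      rw [Real.exp_neg]
      have h3 : 0 < 1 + v + v^2/2 := by positivity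
      calc (Real.exp v)⁻¹ ≤ (1 + v + v^2/2)⁻¹ := by gcongr
        _ ≤ 1 - v + v^2/2 := by
          rw [inv_le_iff_one_le_mul₀ h3]
          nlinarith [sq_nonneg (v^2)]
    have := h (-u) (by linarith)
    rw [neg_neg] at this
    nlinarith [sq_nonneg u, mul_nonneg hη0 (sq_nonneg u)]
  · have h2 := Real.exp_bound' h0.le (hu.trans hη) (n := 3) (by norm_num)
    simp [Finset.sum_range_succ, Nat.factorial] at h2
    have : u ^ 3 ≤ η * u ^ 2 := by nlinarith [sq_nonneg u]
    nlinarith [sq_nonneg u, mul_nonneg hη0 (sq_nonneg u)]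

theorem lil_mgf {Ω : Type*} {mΩ : MeasurableSpace Ω} {μ : Measure Ω} [IsProbabilityMeasure μ]
    (X : Ω → ℝ) (hint : Integrable X μ) (hint2 : Integrable (fun ω => X ω ^ 2) μ)
    (hmean : ∫ ω, X ω ∂μ = 0) (hvar : ∫ ω, X ω ^ 2 ∂μ = 1) {l b η : ℝ} (hl : 0 ≤ l) (hb : 0 ≤ b)
    (hη : η ≤ 1) (hη0 : 0 ≤ η) (hlb : l * b ≤ η) :
    ∫⁻ ω, ENNReal.ofReal (Real.exp (l * min (X ω) b)) ∂μ ≤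
      ENNReal.ofReal (Real.exp ((1 + η) * l ^ 2 / 2)) := by
  have hpt : ∀ ω, Real.exp (l * min (X ω) b) ≤ 1 + l * X ω + (1 + η) * l ^ 2 / 2 * X ω ^ 2 := by
    intro ω
    have hu : l * min (X ω) b ≤ η := le_trans (by gcongr; exact min_le_right _ _) hlb
    have h1 := lil_exp_bound hη hη0 hu
    have h2 : (min (X ω) b) ^ 2 ≤ X ω ^ 2 := by
      rcases le_total (X ω) b with h | h
      · simp [h]
      · rw [min_eq_right h]; gcongr
    have h3 : l * min (X ω) b ≤ l * X ω := by gcongr; exact min_le_left _ _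
    have h4 : (1 + η) * l ^ 2 / 2 * min (X ω) b ^ 2 ≤ (1 + η) * l ^ 2 / 2 * X ω ^ 2 := by gcongr
    nlinarith
  have hI : Integrable (fun ω => 1 + l * X ω + (1 + η) * l ^ 2 / 2 * X ω ^ 2) μ :=
    ((integrable_const _).add (hint.const_mul _)).add (hint2.const_mul _)
  calc _ ≤ ∫⁻ ω, ENNReal.ofReal (1 + l * X ω + (1 + η) * l ^ 2 / 2 * X ω ^ 2) ∂μ :=
        lintegral_mono fun ω => ENNReal.ofReal_le_ofReal (hpt ω)
    _ = ENNReal.ofReal (∫ ω, (1 + l * X ω + (1 + η) * l ^ 2 / 2 * X ω ^ 2) ∂μ) := by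
        rw [ofReal_integral_eq_lintegral_ofReal hI]
        exact Eventually.of_forall fun ω => (Real.exp_pos _).le.trans (hpt ω)
    _ ≤ _ := by
        apply ENNReal.ofReal_le_ofReal
        have hI1 : Integrable (fun ω => 1 + l * X ω) μ := (integrable_const _).add (hint.const_mul _)
        rw [integral_add hI1 (hint2.const_mul _),
          integral_add (integrable_const _) (hint.const_mul _), integral_const_mul, integral_const_mul,
          hmean, hvar]
        simp
        linarith [Real.add_one_le_exp ((1 + η) * l ^ 2 / 2)]

theorem lil_tail {Ω : Type*} {mΩ : MeasurableSpace Ω} {μ : Measure Ω} [IsProbabilityMeasure μ]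
    (X : ℕ → Ω → ℝ) (hX : ∀ i, Measurable (X i)) (hindep : iIndepFun X μ)
    (hident : ∀ i, IdentDistrib (X i) (X 0) μ μ)
    (hint : Integrable (X 0) μ) (hint2 : Integrable (fun ω => X 0 ω ^ 2) μ)
    (hmean : ∫ ω, X 0 ω ∂μ = 0) (hvar : ∫ ω, X 0 ω ^ 2 ∂μ = 1) {l b η N t : ℝ} (hl : 0 ≤ l)
    (hb : 0 ≤ b) (hη : η ≤ 1) (hη0 : 0 ≤ η) (hlb : l * b ≤ η) :
    μ {ω | ∃ i : ℕ, (i : ℝ) ≤ N ∧ t ≤ ∑ j ∈ Finset.range i, min (X j ω) b} ≤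
      ENNReal.ofReal (Real.exp (N * ((1 + η) * l ^ 2 / 2) - l * t)) := by
  set c := (1 + η) * l ^ 2 / 2 with hc
  have hc0 : 0 ≤ c := by positivity
  set g : ℝ → ℝ≥0∞ := fun x => ENNReal.ofReal (Real.exp (l * min x b - c)) with hg
  have hgm : Measurable g := by fun_prop
  have h0 : ∫⁻ ω, g (X 0 ω) ∂μ ≤ 1 := by
    have h := lil_mgf (X 0) hint hint2 hmean hvar hl hb hη hη0 hlb
    have e : ∀ ω, g (X 0 ω) = ENNReal.ofReal (Real.exp (-c)) *
        ENNReal.ofReal (Real.exp (l * min (X 0 ω) b)) := by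
      intro ω
      rw [← ENNReal.ofReal_mul (Real.exp_pos _).le, ← Real.exp_add, hg]
      ring_nf
    simp_rw [e]
    rw [lintegral_const_mul _ (by fun_prop)]
    calc _ ≤ ENNReal.ofReal (Real.exp (-c)) * ENNReal.ofReal (Real.exp c) := by gcongr
      _ = 1 := by rw [← ENNReal.ofReal_mul (Real.exp_pos _).le, ← Real.exp_add]; simp
  have h1 : ∀ i, ∫⁻ ω, g (X i ω) ∂μ ≤ 1 := by
    intro i
    exact ((hident i).comp hgm).lintegral_eq.trans_le h0
  have hv := lil_ville (μ := μ) (ENNReal.ofReal (Real.exp (l * t - N * c))) (fun i ω => g (X i ω))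
    (fun i => hgm.comp (hX i)) (hindep.comp (fun _ => g) (fun _ => hgm)) h1 ⌊N⌋₊
  rw [← ENNReal.ofReal_inv_of_pos (Real.exp_pos _), ← Real.exp_neg, neg_sub] at hv
  refine le_trans (measure_mono ?_) hv
  rintro ω ⟨i, hi, ht⟩
  refine ⟨i, Nat.le_floor hi, ?_⟩
  rw [hg, ← ENNReal.ofReal_prod_of_nonneg (fun _ _ => (Real.exp_pos _).le), ← Real.exp_sum]
  apply ENNReal.ofReal_le_ofReal
  apply Real.exp_le_exp.2
  rw [Finset.sum_sub_distrib, ← Finset.mul_sum]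
  simp only [Finset.sum_const, Finset.card_range, nsmul_eq_mul]
  have := mul_le_mul_of_nonneg_left ht hl
  have := mul_le_mul_of_nonneg_right hi hc0
  linarith


theorem lil_bc {Ω : Type*} {mΩ : MeasurableSpace Ω} {μ : Measure Ω} [IsProbabilityMeasure μ]
    (A : ℕ → Set Ω) (f : ℕ → ℝ) (hf : Summable f) (h : ∀ᶠ k in atTop, μ (A k) ≤ ENNReal.ofReal (f k)) :
    ∀ᵐ ω ∂μ, ∀ᶠ k in atTop, ω ∉ A k := by
  obtain ⟨K, hK⟩ := eventually_atTop.1 h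
  have hs : ∑' k, μ (A (k + K)) ≠ ∞ := by
    have hs' : Summable (fun k => f (k + K)) := (summable_nat_add_iff K).2 hf
    refine ne_top_of_le_ne_top (b := ∑' k, ENNReal.ofReal (f (k + K))) ?_ ?_
    · exact hs'.tsum_ofReal_ne_top
    · exact ENNReal.tsum_le_tsum fun k => hK _ (by omega)
  filter_upwards [ae_eventually_notMem hs] with ω hω
  obtain ⟨K', h'⟩ := eventually_atTop.1 hω
  refine eventually_atTop.2 ⟨K' + K, fun k hk => ?_⟩
  have := h' (k - K) (by omega)
  rwa [Nat.sub_add_cancel (by omega)] at this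

theorem lil_ev1 {q δ : ℝ} (hq : 2 < q) (hδ : 0 < δ) :
    ∀ᶠ x : ℝ in atTop, √(2 * log (log x) / x) * x ^ (1 / q) ≤ δ := by
  have hr : 0 < 1 - 2 / q := by
    rw [sub_pos, div_lt_one (by linarith)]; exact hq
  have h := (isLittleO_log_rpow_atTop hr).bound (c := δ ^ 2 / 2) (by positivity)
  filter_upwards [h, eventually_ge_atTop (Real.exp 1)] with x hx hx1
  have hx0 : 0 < x := (Real.exp_pos 1).trans_le hx1
  have hl : 1 ≤ log x := by rwa [Real.le_log_iff_exp_le hx0]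
  have hll : log (log x) ≤ log x := Real.log_le_self (by linarith)
  rw [Real.norm_of_nonneg (by linarith), Real.norm_of_nonneg (by positivity)] at hx
  have e : x ^ (1 - 2 / q) = x * (x ^ (1 / q))⁻¹ ^ 2 := by
    rw [Real.rpow_sub hx0, Real.rpow_one, show (2 / q) = (1 / q) * (2 : ℕ) by push_cast; ring,
      Real.rpow_mul hx0.le, Real.rpow_natCast]
    field_simp
  have hy : 0 < x ^ (1 / q) := by positivity
  have h2 : 2 * log (log x) / x ≤ (δ * (x ^ (1 / q))⁻¹) ^ 2 := by
    rw [div_le_iff₀ hx0]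
    rw [e] at hx
    nlinarith
  calc _ ≤ √((δ * (x ^ (1 / q))⁻¹) ^ 2) * x ^ (1 / q) := by gcongr
    _ = δ := by
      rw [Real.sqrt_sq (by positivity)]
      field_simp

noncomputable def lilA (x : ℝ) : ℝ := √(2 * x * log (log x))

theorem lil_pow_cmp {δ : ℝ} (hδ : 0 < δ) : ∀ᶠ k : ℕ in atTop, ∀ n : ℕ,
    ((1 + δ) ^ 2) ^ k ≤ (n : ℝ) → lilA (((1 + δ) ^ 2) ^ (k + 1)) ≤ (1 + δ) ^ 2 * lilA n := by
  set θ := (1 + δ) ^ 2 with hθ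
  have hθ1 : 1 < θ := by rw [hθ]; nlinarith
  have hlθ : 0 < log θ := Real.log_pos hθ1
  have ht : Tendsto (fun k : ℕ => log (k * log θ)) atTop atTop :=
    Real.tendsto_log_atTop.comp (tendsto_natCast_atTop_atTop.atTop_mul_const hlθ)
  filter_upwards [ht.eventually_ge_atTop (log 2 / δ), eventually_ge_atTop 1] with k hk hk1 n hn
  have hk1' : (1 : ℝ) ≤ k := by exact_mod_cast hk1
  have h2 : 0 < log 2 := Real.log_pos (by norm_num)
  have hk0 : 0 < log (k * log θ) := lt_of_lt_of_le (by positivity) hk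
  have hNpos : 0 < θ ^ k := by positivity
  have hkn : log (k * log θ) ≤ log (log n) := by
    have : (k * log θ) ≤ log n := by
      rw [← Real.log_pow]; exact Real.log_le_log hNpos hn
    exact Real.log_le_log (by positivity) this
  have hk2 : log (log (θ ^ (k+1))) ≤ (1 + δ) * log (k * log θ) := by
    rw [Real.log_pow]
    calc log (((k + 1 : ℕ) : ℝ) * log θ) ≤ log (2 * (k * log θ)) := by
          apply Real.log_le_log (by positivity)
          push_cast; nlinarith
      _ = log 2 + log (k * log θ) := Real.log_mul (by norm_num) (by positivity)
      _ ≤ _ := by rw [div_le_iff₀ hδ] at hk; linarith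
  have hn0 : 0 < (n : ℝ) := hNpos.trans_le hn
  rw [lilA, lilA]
  calc √(2 * θ ^ (k + 1) * log (log (θ ^ (k + 1)))) ≤ √(((1 + δ)^2) ^ 2 * (2 * n * log (log n))) := by
        apply Real.sqrt_le_sqrt
        have h3 : 2 * θ ^ (k+1) * log (log (θ ^ (k + 1))) ≤ 2 * θ ^ (k+1) * ((1 + δ) * log (log n)) := by
          gcongr
          exact hk2.trans (by gcongr)
        have h4 : 2 * θ ^ (k+1) * ((1 + δ) * log (log n)) ≤ 2 * (θ * n) * (θ * log (log n)) := by
          have : 0 < log (log n) := hk0.trans_le hkn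
          have h5 : θ ^ (k+1) ≤ θ * n := by rw [pow_succ']; gcongr
          have h6 : 1 + δ ≤ θ := by rw [hθ]; nlinarith
          gcongr
        refine (h3.trans h4).trans (le_of_eq ?_)
        rw [← hθ]; ring
    _ = _ := by
      rw [Real.sqrt_mul (by positivity), Real.sqrt_sq (by positivity)]

theorem lil_upper {Ω : Type*} {mΩ : MeasurableSpace Ω} {μ : Measure Ω} [IsProbabilityMeasure μ]
    (X : ℕ → Ω → ℝ) (hX : ∀ i, Measurable (X i)) (hindep : iIndepFun X μ)
    (hident : ∀ i, IdentDistrib (X i) (X 0) μ μ)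
    (hint : Integrable (X 0) μ) (hint2 : Integrable (fun ω => X 0 ω ^ 2) μ)
    (hmean : ∫ ω, X 0 ω ∂μ = 0) (hvar : ∫ ω, X 0 ω ^ 2 ∂μ = 1)
    (p : ℝ) (hp : 2 < p) (hmom : Integrable (fun ω => |X 0 ω| ^ p) μ) {ε : ℝ} (hε : 0 < ε) :
    ∀ᵐ ω ∂μ, ∀ᶠ n : ℕ in atTop, ∑ j ∈ Finset.range n, X j ω ≤ (1 + ε) * lilA n := by
  obtain ⟨δ, hδ, hδ1, hδε⟩ : ∃ δ : ℝ, 0 < δ ∧ δ ≤ 1 ∧ (1 + δ) ^ 3 ≤ 1 + ε := by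
    refine ⟨min 1 (ε / 7), by positivity, min_le_left _ _, ?_⟩
    set d := min 1 (ε / 7) with hd
    have h1 : d ≤ 1 := min_le_left _ _
    have h2 : d ≤ ε / 7 := min_le_right _ _
    have h0 : 0 < d := by positivity
    have : d ^ 2 ≤ d := by nlinarith
    have : d ^ 3 ≤ d := by nlinarith
    nlinarith
  set θ := (1 + δ) ^ 2 with hθ
  have hθ1 : 1 < θ := by rw [hθ]; nlinarith
  have hlθ : 0 < log θ := Real.log_pos hθ1
  have hNt : Tendsto (fun k : ℕ => θ ^ k) atTop atTop := tendsto_pow_atTop_atTop_of_one_lt hθ1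
  obtain ⟨q, hq2, hqp⟩ := exists_between hp
  set b : ℕ → ℝ := fun k => (θ ^ k) ^ (1 / q) with hb
  have hA : ∀ᵐ ω ∂μ, ∀ᶠ k : ℕ in atTop, ω ∉ {ω | ∃ i : ℕ, (i : ℝ) ≤ θ ^ k ∧
      (1 + δ) * lilA (θ ^ k) ≤ ∑ j ∈ Finset.range i, min (X j ω) (b k)} := by
    refine lil_bc _ (fun k => (log θ) ^ (-(1 + δ)) * (k : ℝ) ^ (-(1 + δ))) ?_ ?_
    · exact (Real.summable_nat_rpow.2 (by linarith)).mul_left _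
    have ht : Tendsto (fun k : ℕ => log (log (θ ^ k))) atTop atTop :=
      Real.tendsto_log_atTop.comp (Real.tendsto_log_atTop.comp hNt)
    filter_upwards [hNt.eventually (lil_ev1 hq2 hδ), ht.eventually_gt_atTop 0,
      eventually_ge_atTop 1] with k hk hk2 hk1
    have hk1' : (0 : ℝ) < k := by exact_mod_cast hk1
    refine (lil_tail X hX hindep hident hint hint2 hmean hvar (l := √(2 * log (log (θ ^ k)) / θ ^ k))
      (η := δ) (b := b k) (by positivity) (by positivity) hδ1 hδ.le hk).trans ?_
    apply ENNReal.ofReal_le_ofReal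
    have hN : 0 < θ ^ k := by positivity
    set N := θ ^ k with hNdef
    set ℓ := log (log N) with hℓ
    have e1 : √(2 * ℓ / N) * lilA N = 2 * ℓ := by
      rw [lilA, ← hℓ, ← Real.sqrt_mul (by positivity)]
      rw [show 2 * ℓ / N * (2 * N * ℓ) = (2 * ℓ) ^ 2 by field_simp, Real.sqrt_sq (by positivity)]
    have e2 : N * ((1 + δ) * √(2 * ℓ / N) ^ 2 / 2) - √(2 * ℓ / N) * ((1 + δ) * lilA N) =
        ℓ * (-(1 + δ)) := by
      rw [Real.sq_sqrt (by positivity), show √(2 * ℓ / N) * ((1 + δ) * lilA N) =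
        (1 + δ) * (√(2 * ℓ / N) * lilA N) by ring, e1]
      field_simp; ring
    rw [e2, hℓ, hNdef, Real.log_pow, ← Real.rpow_def_of_pos (by positivity),
      Real.mul_rpow hk1'.le hlθ.le, mul_comm]
  have hC : ∀ᵐ ω ∂μ, ∀ᶠ k : ℕ in atTop, ω ∉ ⋃ j ∈ Finset.range ⌈θ ^ k⌉₊, {ω | b k ≤ X j ω} := by
    set K := ∫ ω, |X 0 ω| ^ p ∂μ with hK
    have hK0 : 0 ≤ K := integral_nonneg fun ω => by positivity
    have hr0 : 0 < θ ^ (1 - p / q) := by positivity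
    have hr1 : θ ^ (1 - p / q) < 1 := by
      apply Real.rpow_lt_one_of_one_lt_of_neg hθ1
      rw [sub_neg, one_lt_div (by linarith)]; exact hqp
    refine lil_bc _ (fun k => (2 * K) * (θ ^ (1 - p / q)) ^ k) ?_ ?_
    · exact (summable_geometric_of_lt_one hr0.le hr1).mul_left _
    refine Eventually.of_forall fun k => ?_
    have hN : 0 < θ ^ k := by positivity
    have hN1 : 1 ≤ θ ^ k := one_le_pow₀ hθ1.le
    have hbk : 0 < b k := by positivity
    have hj : ∀ j, μ {ω | b k ≤ X j ω} ≤ ENNReal.ofReal (K / (b k) ^ p) := by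
      intro j
      have : μ {ω | b k ≤ X j ω} = μ {ω | b k ≤ X 0 ω} :=
        (hident j).measure_mem_eq (s := Set.Ici (b k)) measurableSet_Ici
      rw [this]
      have hm := mul_meas_ge_le_integral_of_nonneg (μ := μ)
        (Eventually.of_forall fun ω => by positivity : 0 ≤ᵐ[μ] fun ω => |X 0 ω| ^ p) hmom ((b k) ^ p)
      have hm2 : μ.real {ω | b k ^ p ≤ |X 0 ω| ^ p} ≤ K / (b k) ^ p := by
        rw [le_div_iff₀ (by positivity), mul_comm]; exact hm
      refine (measure_mono ?_).trans (ENNReal.le_ofReal_iff_toReal_le (measure_ne_top _ _) (by positivity) |>.2 hm2)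
      intro ω hω
      have : b k ≤ |X 0 ω| := le_trans hω (le_abs_self _)
      exact Real.rpow_le_rpow hbk.le this (by linarith)
    refine (measure_biUnion_finset_le _ _).trans ((Finset.sum_le_sum fun j _ => hj j).trans ?_)
    rw [Finset.sum_const, Finset.card_range, nsmul_eq_mul, ← ENNReal.ofReal_natCast,
      ← ENNReal.ofReal_mul (by positivity)]
    apply ENNReal.ofReal_le_ofReal
    have hceil : (⌈θ ^ k⌉₊ : ℝ) ≤ 2 * θ ^ k := by
      have := (Nat.ceil_lt_add_one hN.le).le
      linarith
    have e : (b k) ^ p = (θ ^ k) ^ (p / q) := by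
      rw [hb, ← Real.rpow_mul hN.le]; congr 1; ring
    have e2 : (θ ^ (1 - p / q)) ^ k = θ ^ k / (θ ^ k) ^ (p / q) := by
      rw [← Real.rpow_natCast, ← Real.rpow_mul (by positivity), mul_comm, Real.rpow_mul (by positivity),
        Real.rpow_natCast, Real.rpow_sub hN, Real.rpow_one]
    rw [e, e2]
    calc _ ≤ (2 * θ ^ k) * (K / (θ ^ k) ^ (p / q)) := by gcongr
      _ = _ := by ring
  filter_upwards [hA, hC] with ω hωA hωC
  have hall := (hωA.and hωC)
  have hall2 := ((tendsto_add_atTop_nat 1).eventually hall).and (lil_pow_cmp hδ)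
  obtain ⟨K, hK⟩ := eventually_atTop.1 hall2
  filter_upwards [tendsto_natCast_atTop_atTop.eventually_ge_atTop (θ ^ (K + 1))] with n hn
  have hn1 : (1 : ℝ) ≤ n := (one_le_pow₀ hθ1.le).trans hn
  obtain ⟨k, hk1, hk2⟩ := exists_nat_pow_near hn1 hθ1
  have hkK : K ≤ k := by
    have := (pow_lt_pow_iff_right₀ hθ1).1 (hn.trans_lt hk2)
    omega
  obtain ⟨⟨h1, h2⟩, h3⟩ := hK k hkK
  have h4 := h3 n hk1
  have heq : ∑ j ∈ Finset.range n, min (X j ω) (b (k + 1)) = ∑ j ∈ Finset.range n, X j ω := by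
    refine Finset.sum_congr rfl fun j hj => min_eq_left ?_
    by_contra hcon
    apply h2
    simp only [Set.mem_iUnion]
    refine ⟨j, ?_, (not_le.1 hcon).le⟩
    rw [Finset.mem_range] at hj ⊢
    refine hj.trans_le ?_
    have : (n : ℝ) ≤ ⌈θ ^ (k+1)⌉₊ := hk2.le.trans (Nat.le_ceil _)
    exact_mod_cast this
  have h5 : ∑ j ∈ Finset.range n, X j ω < (1 + δ) * lilA (θ ^ (k + 1)) := by
    by_contra hcon
    exact h1 ⟨n, hk2.le, by rw [heq]; exact not_lt.1 hcon⟩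
  have hA0 : 0 ≤ lilA n := Real.sqrt_nonneg _
  calc _ ≤ (1 + δ) * lilA (θ ^ (k + 1)) := h5.le
    _ ≤ (1 + δ) * ((1 + δ) ^ 2 * lilA n) := by gcongr
    _ = (1 + δ) ^ 3 * lilA n := by ring
    _ ≤ _ := by gcongr


theorem lil_gauss {η : ℝ} (hη : 0 < η) : ∃ x : ℝ, 0 < x ∧
    ENNReal.ofReal (Real.exp (-(1 + η) * x ^ 2 / 2)) < gaussianReal 0 1 (Set.Ioi x) := by
  refine ⟨6 / η + 6, by positivity, ?_⟩
  set x := 6 / η + 6 with hx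
  have hx6 : 6 < x := by rw [hx]; have : 0 < 6 / η := by positivity
                         linarith
  have hxη : 6 ≤ η * x := by rw [hx, mul_add, mul_div_cancel₀ _ hη.ne']; nlinarith
  have h1 : ENNReal.ofReal (Real.exp (-2) * Real.exp (-(x+1)^2/2)) ≤ gaussianReal 0 1 (Set.Ioi x) := by
    calc _ = ∫⁻ _ in Set.Ioc x (x + 1), ENNReal.ofReal (Real.exp (-2) * Real.exp (-(x+1)^2/2)) := by
          simp
      _ ≤ ∫⁻ y in Set.Ioc x (x + 1), gaussianPDF 0 1 y := by
          refine setLIntegral_mono (measurable_gaussianPDF 0 1) fun y hy => ?_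
          rw [gaussianPDF]
          apply ENNReal.ofReal_le_ofReal
          rw [gaussianPDFReal]
          simp only [NNReal.coe_one, mul_one, sub_zero]
          have hpi : √(2 * π) ≤ Real.exp 2 := by
            rw [Real.sqrt_le_left (Real.exp_pos _).le]
            have h3 : 2 + 1 ≤ Real.exp 2 := Real.add_one_le_exp 2
            nlinarith [Real.pi_lt_four]
          gcongr ?_ * Real.exp ?_
          · rw [Real.exp_neg]
            gcongr
          · have := hy.1; have := hy.2
            gcongr
            linarith
      _ ≤ ∫⁻ y in Set.Ioi x, gaussianPDF 0 1 y := lintegral_mono_set Set.Ioc_subset_Ioi_self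
      _ = _ := (gaussianReal_apply 0 one_ne_zero _).symm
  refine lt_of_lt_of_le ?_ h1
  rw [← Real.exp_add]
  refine (ENNReal.ofReal_lt_ofReal_iff (Real.exp_pos _)).2 (Real.exp_lt_exp.2 ?_)
  nlinarith

theorem lil_clt {Ω : Type*} {mΩ : MeasurableSpace Ω} {μ : Measure Ω} [IsProbabilityMeasure μ]
    (X : ℕ → Ω → ℝ) (hX : ∀ i, Measurable (X i)) (hindep : iIndepFun X μ)
    (hident : ∀ i, IdentDistrib (X i) (X 0) μ μ)
    (hmean : ∫ ω, X 0 ω ∂μ = 0) (hvar : ∫ ω, X 0 ω ^ 2 ∂μ = 1) {η : ℝ} (hη : 0 < η) :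
    ∃ x : ℝ, 0 < x ∧ ∀ᶠ n : ℕ in atTop, ENNReal.ofReal (Real.exp (-(1 + η) * x ^ 2 / 2)) ≤
      μ {ω | x * √n ≤ ∑ j ∈ Finset.range n, X j ω} := by
  obtain ⟨x, hx, h⟩ := lil_gauss hη
  refine ⟨x, hx, ?_⟩
  have hT := (tendstoInDistribution_inv_sqrt_mul_sum (HasLaw.id (μ := gaussianReal 0 1)) hmean
    (by simpa using hvar) hindep hident).tendsto
  have h2 := ProbabilityMeasure.le_liminf_measure_open_of_tendsto hT (isOpen_Ioi (a := x))
  simp only [ProbabilityMeasure.coe_mk, Measure.map_id] at h2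
  have h3 := eventually_lt_of_lt_liminf (h.trans_le h2)
  filter_upwards [h3, eventually_gt_atTop 0] with n hn hn0
  refine hn.le.trans ?_
  rw [Measure.map_apply (by fun_prop) measurableSet_Ioi]
  refine measure_mono fun ω hω => ?_
  have hω' : x < (√n)⁻¹ * ∑ k ∈ Finset.range n, X k ω := hω
  have hs : 0 < √(n : ℝ) := Real.sqrt_pos.2 (by exact_mod_cast hn0)
  rw [inv_mul_eq_div, lt_div_iff₀ hs] at hω'
  exact hω'.le

theorem lil_shift {Ω : Type*} {mΩ : MeasurableSpace Ω} {μ : Measure Ω}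
    (X : ℕ → Ω → ℝ) (hindep : iIndepFun X μ)
    (hident : ∀ i, IdentDistrib (X i) (X 0) μ μ) (u n : ℕ) (t : ℝ) :
    μ {ω | t ≤ ∑ j ∈ Finset.Ico u (u + n), X j ω} = μ {ω | t ≤ ∑ j ∈ Finset.range n, X j ω} := by
  have h1 : iIndepFun (fun j => X (u + j)) μ := hindep.precomp (g := fun j => u + j) (add_right_injective u)
  have h2 := IdentDistrib.pi (X := fun j => X (u + j)) (Y := X) (μ := μ) (ν := μ)
    (fun j => (hident _).trans (hident j).symm) h1 hindep
  have h3 := h2.comp (u := fun f : ℕ → ℝ => ∑ j ∈ Finset.range n, f j) (by fun_prop)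
  have := h3.measure_mem_eq (s := Set.Ici t) measurableSet_Ici
  simp_rw [Finset.sum_Ico_eq_sum_range, Nat.add_sub_cancel_left]
  exact this

theorem lil_sum_meas {Ω : Type*}
    (X : ℕ → Ω → ℝ) (S : Finset ℕ) (T : Set ℕ) (hST : ∀ i ∈ S, i ∈ T) (t : ℝ) :
    MeasurableSet[⨆ i ∈ T, MeasurableSpace.comap (X i) inferInstance]
      {ω | t ≤ ∑ j ∈ S, X j ω} := by
  have hm : Measurable[⨆ i ∈ T, MeasurableSpace.comap (X i) inferInstance]
      (fun ω => ∑ j ∈ S, X j ω) := by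
    refine Finset.measurable_sum S fun i hi => ?_
    refine Measurable.mono (comap_measurable (X i)) ?_ le_rfl
    exact le_iSup₂_of_le (f := fun i (_ : i ∈ T) => MeasurableSpace.comap (X i) inferInstance) i
      (hST i hi) le_rfl
  exact hm measurableSet_Ici

/-- block event -/
def lilE {Ω : Type*} (X : ℕ → Ω → ℝ) (u m l : ℕ) (t : ℝ) : Set Ω :=
  ⋂ r ∈ Finset.range m, {ω | t ≤ ∑ j ∈ Finset.Ico (u + r * l) (u + r * l + l), X j ω}

theorem lilE_meas {Ω : Type*}
    (X : ℕ → Ω → ℝ) (u m l v : ℕ) (t : ℝ) (h : u + m * l ≤ v) :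
    MeasurableSet[⨆ i ∈ Set.Ico u v, MeasurableSpace.comap (X i) inferInstance] (lilE X u m l t) := by
  refine Finset.measurableSet_biInter _ fun r hr => ?_
  refine lil_sum_meas X _ _ (fun i hi => ?_) t
  rw [Finset.mem_Ico] at hi
  rw [Finset.mem_range] at hr
  have : (r + 1) * l ≤ m * l := Nat.mul_le_mul_right _ hr
  rw [add_mul, one_mul] at this
  constructor <;> omega

theorem lilE_prob {Ω : Type*} {mΩ : MeasurableSpace Ω} {μ : Measure Ω} 
    (X : ℕ → Ω → ℝ) (hX : ∀ i, Measurable (X i)) (hindep : iIndepFun X μ)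
    (hident : ∀ i, IdentDistrib (X i) (X 0) μ μ) (u m l : ℕ) (t : ℝ) :
    μ (lilE X u m l t) = (μ {ω | t ≤ ∑ j ∈ Finset.range l, X j ω}) ^ m := by
  rw [lilE, lil_meas_biInter (fun i => (hX i).comap_le) hindep.iIndep
    (fun r => Set.Ico (u + r * l) (u + r * l + l)) ?_ _ ?_]
  · simp_rw [lil_shift X hindep hident]
    simp
  · have key : ∀ r s : ℕ, r < s → Disjoint (Set.Ico (u + r * l) (u + r * l + l))
        (Set.Ico (u + s * l) (u + s * l + l)) := by
      intro r s hrs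
      rw [Set.disjoint_left]
      rintro i ⟨_, h1⟩ ⟨h2, _⟩
      have : (r + 1) * l ≤ s * l := Nat.mul_le_mul_right _ hrs
      rw [add_mul, one_mul] at this
      omega
    intro r s hrs
    rcases lt_or_gt_of_ne hrs with h | h
    · exact key r s h
    · exact (key s r h).symm
  · intro r
    exact lil_sum_meas X _ _ (fun i hi => by simpa using hi) t

theorem lilE_sum {Ω : Type*} (X : ℕ → Ω → ℝ) (u m l : ℕ) (t : ℝ) (ω : Ω) (h : ω ∈ lilE X u m l t) :
    ∑ j ∈ Finset.range u, X j ω + m * t ≤ ∑ j ∈ Finset.range (u + m * l), X j ω := by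
  induction m with
  | zero => simp
  | succ m ih =>
    have h1 : ω ∈ lilE X u m l t := by
      simp only [lilE, Set.mem_iInter] at h ⊢
      exact fun r hr => h r (by simp at hr ⊢; omega)
    have h2 : t ≤ ∑ j ∈ Finset.Ico (u + m * l) (u + m * l + l), X j ω := by
      simp only [lilE, Set.mem_iInter] at h
      exact h m (by simp)
    have h3 := Finset.sum_range_add_sum_Ico (fun j => X j ω) (show u + m * l ≤ u + m * l + l by omega)
    rw [show u + (m + 1) * l = u + m * l + l by ring, ← h3]
    push_cast
    linarith [ih h1]


theorem lilA_mono {s t : ℝ} (hs : Real.exp 1 ≤ s) (hst : s ≤ t) : lilA s ≤ lilA t := by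
  have hs0 : 0 < s := (Real.exp_pos 1).trans_le hs
  have hl : 1 ≤ log s := by rwa [Real.le_log_iff_exp_le hs0]
  have hl2 : log s ≤ log t := Real.log_le_log hs0 hst
  have hll : log (log s) ≤ log (log t) := Real.log_le_log (by linarith) hl2
  have h0 : 0 ≤ log (log s) := Real.log_nonneg hl
  unfold lilA
  have ht0 : 0 < t := hs0.trans_le hst
  apply Real.sqrt_le_sqrt
  have : 2 * s ≤ 2 * t := by linarith
  exact mul_le_mul this hll h0 (by positivity)

noncomputable def lilW (B k : ℕ) : ℝ := log (log ((B : ℝ) ^ (k + 1)))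
noncomputable def lilM (γ x : ℝ) (B k : ℕ) : ℕ := ⌈2 * (1 - γ) ^ 2 * lilW B k / x ^ 2⌉₊
noncomputable def lilL (γ x : ℝ) (B k : ℕ) : ℕ := (B ^ (k + 1) - B ^ k) / lilM γ x B k

theorem lilW_tendsto {B : ℕ} (hB : 2 ≤ B) : Tendsto (lilW B) atTop atTop := by
  have hB1 : (1 : ℝ) < B := by exact_mod_cast hB
  exact Real.tendsto_log_atTop.comp (Real.tendsto_log_atTop.comp
    ((tendsto_pow_atTop_atTop_of_one_lt hB1).comp (tendsto_add_atTop_nat 1)))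

theorem lilM_small {γ x : ℝ} (hx : 0 < x) {B : ℕ} (hB : 2 ≤ B) :
    Tendsto (fun k => (lilM γ x B k : ℝ) / (B : ℝ) ^ k) atTop (nhds 0) := by
  have hB1 : (1 : ℝ) < B := by exact_mod_cast hB
  have hlB : 0 < log B := Real.log_pos hB1
  set C : ℝ := 2 * (1 - γ) ^ 2 / x ^ 2 with hC
  have hC0 : 0 ≤ C := by positivity
  have hM : ∀ᶠ k in atTop, (lilM γ x B k : ℝ) ≤ (C * log B + 1) * ((k + 1 : ℕ) : ℝ) := by
    filter_upwards [(lilW_tendsto hB).eventually_ge_atTop 0] with k hk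
    have h1 : (lilM γ x B k : ℝ) ≤ C * lilW B k + 1 := by
      have : 2 * (1 - γ) ^ 2 * lilW B k / x ^ 2 = C * lilW B k := by rw [hC]; ring
      rw [lilM, this]
      exact (Nat.ceil_lt_add_one (by positivity)).le
    have h2 : lilW B k ≤ ((k + 1 : ℕ) : ℝ) * log B := by
      rw [lilW, Real.log_pow]
      exact Real.log_le_self (by positivity)
    have h3 : (1 : ℝ) ≤ ((k + 1 : ℕ) : ℝ) := by push_cast; linarith [(Nat.cast_nonneg k : (0:ℝ) ≤ k)]
    nlinarith [mul_le_mul_of_nonneg_left h2 hC0]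
  have h0 : Tendsto (fun k : ℕ => ((k + 1 : ℕ) : ℝ) / (B : ℝ) ^ (k + 1)) atTop (nhds 0) := by
    have := tendsto_pow_const_div_const_pow_of_one_lt 1 hB1
    simp only [pow_one] at this
    exact this.comp (tendsto_add_atTop_nat 1)
  have h4 := h0.const_mul ((C * log B + 1) * B)
  rw [mul_zero] at h4
  refine squeeze_zero' (Eventually.of_forall fun k => by positivity) ?_ h4
  filter_upwards [hM] with k hk
  calc _ ≤ (C * log B + 1) * ((k + 1 : ℕ) : ℝ) / (B : ℝ) ^ k := by gcongr
    _ = _ := by rw [pow_succ]; field_simp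

theorem lilM_pos {γ x : ℝ} (hγ1 : γ < 1) (hx : 0 < x) {B : ℕ} (hB : 2 ≤ B) :
    ∀ᶠ k in atTop, 0 < lilM γ x B k := by
  filter_upwards [(lilW_tendsto hB).eventually_gt_atTop 0] with k hk
  rw [lilM, Nat.ceil_pos]
  have : 0 < 1 - γ := by linarith
  positivity

theorem lilL_tendsto {γ x : ℝ} (hγ1 : γ < 1) (hx : 0 < x) {B : ℕ} (hB : 2 ≤ B) :
    Tendsto (lilL γ x B) atTop atTop := by
  rw [tendsto_atTop]
  intro L
  have h := lilM_small (γ := γ) hx hB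
  have h1 := h.eventually_lt_const (u := 1 / ((L : ℝ) + 1)) (by positivity)
  filter_upwards [h1, lilM_pos hγ1 hx hB] with k hk hm
  rw [lilL, Nat.le_div_iff_mul_le hm]
  have hBk : 0 < (B : ℝ) ^ k := by positivity
  rw [div_lt_div_iff₀ hBk (by positivity)] at hk
  have h2 : L * lilM γ x B k ≤ B ^ k := by
    have : ((L * lilM γ x B k : ℕ) : ℝ) ≤ ((B ^ k : ℕ) : ℝ) := by
      push_cast
      nlinarith [(Nat.cast_nonneg (lilM γ x B k) : (0:ℝ) ≤ _)]
    exact_mod_cast this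
  have h3 : 2 * B ^ k ≤ B ^ (k + 1) := by rw [pow_succ']; gcongr
  omega

theorem lil_det {γ x : ℝ} (hγ : 0 < γ) (hγ1 : γ < 1) (hx : 0 < x) {B : ℕ} (hB : 2 ≤ B)
    (hB1 : 2 ≤ γ * B) (hB2 : 1 ≤ γ ^ 2 * B) :
    ∀ᶠ k in atTop,
      (1 - γ) ^ 2 * lilA ((B : ℝ) ^ (k + 1)) ≤ lilM γ x B k * (x * √(lilL γ x B k)) ∧
      lilA ((B ^ k : ℕ) : ℝ) ≤ γ * lilA ((B : ℝ) ^ (k + 1)) ∧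
      lilA ((B ^ k + lilM γ x B k * lilL γ x B k : ℕ) : ℝ) ≤ lilA ((B : ℝ) ^ (k + 1)) := by
  have hBr : (1 : ℝ) < B := by exact_mod_cast hB
  have hBt : Tendsto (fun k : ℕ => (B : ℝ) ^ k) atTop atTop := tendsto_pow_atTop_atTop_of_one_lt hBr
  filter_upwards [(lilM_small (γ := γ) hx hB).eventually_lt_const (u := 1) (by norm_num),
    lilM_pos hγ1 hx hB, (lilW_tendsto hB).eventually_gt_atTop 0,
    hBt.eventually_ge_atTop (Real.exp 1)] with k h1 hm hw he
  set N : ℝ := (B : ℝ) ^ (k + 1) with hN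
  set m := lilM γ x B k with hmdef
  set l := lilL γ x B k with hldef
  set w := lilW B k with hwdef
  have hBk : 0 < (B : ℝ) ^ k := by positivity
  have hNB : N = B * (B : ℝ) ^ k := by rw [hN, pow_succ']
  have hNpos : 0 < N := by positivity
  have hAN : lilA N = √(2 * N * w) := rfl
  rw [div_lt_one hBk] at h1
  have hpow : B ^ k ≤ B ^ (k + 1) := Nat.pow_le_pow_right (by omega) (by omega)
  have hml : m * l ≤ B ^ (k + 1) - B ^ k := Nat.mul_div_le _ _
  have hml2 : B ^ (k + 1) - B ^ k < m * l + m := by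
    have h := Nat.lt_mul_div_succ (B ^ (k + 1) - B ^ k) hm
    rw [mul_add, mul_one] at h
    exact h
  have hml2' : N - (B : ℝ) ^ k ≤ m * l + m := by
    have h3 : B ^ (k + 1) ≤ m * l + m + B ^ k := by omega
    have : ((B ^ (k + 1) : ℕ) : ℝ) ≤ ((m * l + m + B ^ k : ℕ) : ℝ) := by exact_mod_cast h3
    push_cast at this
    rw [hN]; linarith
  refine ⟨?_, ?_, ?_⟩
  · have hmx : 2 * (1 - γ) ^ 2 * w ≤ m * x ^ 2 := by
      have : 2 * (1 - γ) ^ 2 * w / x ^ 2 ≤ m := Nat.le_ceil _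
      rwa [div_le_iff₀ (by positivity)] at this
    have hmlN : (1 - γ) ^ 2 * N ≤ m * l := by
      have : 2 * (B : ℝ) ^ k ≤ γ * N := by rw [hNB]; nlinarith
      nlinarith
    rw [hAN]
    have hlhs : (1 - γ) ^ 2 * √(2 * N * w) = √((2 * (1 - γ) ^ 2 * w) * ((1 - γ) ^ 2 * N)) := by
      rw [show (2 * (1 - γ) ^ 2 * w) * ((1 - γ) ^ 2 * N) = ((1 - γ) ^ 2) ^ 2 * (2 * N * w) by ring,
        Real.sqrt_mul (x := ((1 - γ) ^ 2) ^ 2) (by positivity), Real.sqrt_sq (by positivity)]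
    have hrhs : (m : ℝ) * (x * √l) = √((m * x ^ 2) * (m * l)) := by
      rw [show ((m : ℝ) * x ^ 2) * (m * l) = (m * x) ^ 2 * l by ring,
        Real.sqrt_mul (by positivity), Real.sqrt_sq (by positivity)]
      ring
    rw [hlhs, hrhs]
    gcongr
  · have : γ * lilA N = √(γ ^ 2 * (2 * N * w)) := by
      rw [Real.sqrt_mul (x := γ ^ 2) (by positivity), Real.sqrt_sq hγ.le, hAN]
    rw [this, lilA]
    apply Real.sqrt_le_sqrt
    push_cast
    have hl : 1 ≤ log ((B : ℝ) ^ k) := by rwa [Real.le_log_iff_exp_le hBk]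
    have hle : (B : ℝ) ^ k ≤ N := by rw [hN]; exact pow_le_pow_right₀ hBr.le (by omega)
    have hlw : log (log ((B : ℝ) ^ k)) ≤ w :=
      Real.log_le_log (by linarith) (Real.log_le_log hBk hle)
    calc _ ≤ 2 * (B : ℝ) ^ k * w := by gcongr
      _ ≤ 2 * (γ ^ 2 * N) * w := by
        gcongr
        rw [hNB]; nlinarith
      _ = _ := by ring
  · apply lilA_mono
    · refine he.trans ?_
      push_cast
      have : (0 : ℝ) ≤ m * l := by positivity
      linarith
    · have h3 : B ^ k + m * l ≤ B ^ (k + 1) := by omega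
      rw [hN]
      exact_mod_cast h3

theorem lil_lower {Ω : Type*} {mΩ : MeasurableSpace Ω} {μ : Measure Ω} [IsProbabilityMeasure μ]
    (X : ℕ → Ω → ℝ) (hX : ∀ i, Measurable (X i)) (hindep : iIndepFun X μ)
    (hident : ∀ i, IdentDistrib (X i) (X 0) μ μ)
    (hmean : ∫ ω, X 0 ω ∂μ = 0) (hvar : ∫ ω, X 0 ω ^ 2 ∂μ = 1)
    (hlow : ∀ᵐ ω ∂μ, ∀ᶠ n : ℕ in atTop, - (2 * lilA n) ≤ ∑ j ∈ Finset.range n, X j ω)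
    {ε : ℝ} (hε : 0 < ε) (hε1 : ε < 1) :
    ∀ᵐ ω ∂μ, ∃ᶠ n : ℕ in atTop, (1 - ε) * lilA n ≤ ∑ j ∈ Finset.range n, X j ω := by
  set γ := ε / 4 with hγdef
  have hγ : 0 < γ := by positivity
  have hγ1 : γ < 1 := by linarith
  obtain ⟨x, hx, hclt⟩ := lil_clt X hX hindep hident hmean hvar hγ
  obtain ⟨B, hBB⟩ := exists_nat_ge (2 / γ + 1 / γ ^ 2 + 2)
  have hg1 : 0 < 2 / γ := by positivity
  have hg2 : 0 < 1 / γ ^ 2 := by positivity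
  have hB : 2 ≤ B := by
    have : (2 : ℝ) ≤ B := by linarith
    exact_mod_cast this
  have hB1 : 2 ≤ γ * B := by
    have : 2 / γ ≤ B := by linarith
    rwa [div_le_iff₀' hγ] at this
  have hB2 : 1 ≤ γ ^ 2 * B := by
    have : 1 / γ ^ 2 ≤ B := by linarith
    rwa [div_le_iff₀' (by positivity)] at this
  have hBr : (1 : ℝ) < B := by exact_mod_cast hB
  have hlB : 0 < log B := Real.log_pos hBr
  set E : ℕ → Set Ω := fun k =>
    lilE X (B ^ k) (lilM γ x B k) (lilL γ x B k) (x * √(lilL γ x B k)) with hE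
  have hEm : ∀ k, MeasurableSet[⨆ i ∈ Set.Ico (B ^ k) (B ^ (k + 1)),
      MeasurableSpace.comap (X i) inferInstance] (E k) := by
    intro k
    refine lilE_meas X _ _ _ _ _ ?_
    have hml : lilM γ x B k * lilL γ x B k ≤ B ^ (k + 1) - B ^ k := Nat.mul_div_le _ _
    have hpow : B ^ k ≤ B ^ (k + 1) := Nat.pow_le_pow_right (by omega) (by omega)
    omega
  have hEm' : ∀ k, MeasurableSet (E k) := fun k =>
    (iSup₂_le fun i _ => (hX i).comap_le : (⨆ i ∈ Set.Ico (B ^ k) (B ^ (k + 1)),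
      MeasurableSpace.comap (X i) inferInstance) ≤ mΩ) _ (hEm k)
  have hEi : iIndepSet E μ := by
    rw [iIndepSet_iff_meas_biInter hEm']
    refine lil_meas_biInter (fun i => (hX i).comap_le) hindep.iIndep
      (fun k => Set.Ico (B ^ k) (B ^ (k + 1))) ?_ E hEm
    have key : ∀ r s : ℕ, r < s → Disjoint (Set.Ico (B ^ r) (B ^ (r + 1)))
        (Set.Ico (B ^ s) (B ^ (s + 1))) := by
      intro r s hrs
      rw [Set.disjoint_left]
      rintro i ⟨_, h1⟩ ⟨h2, _⟩
      have : B ^ (r + 1) ≤ B ^ s := Nat.pow_le_pow_right (by omega) hrs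
      omega
    intro r s hrs
    rcases lt_or_gt_of_ne hrs with h | h
    · exact key r s h
    · exact (key s r h).symm
  set D := Real.exp (-(1 + γ) * x ^ 2 / 2) with hD
  have hD0 : 0 < D := Real.exp_pos _
  have hprob : ∀ᶠ k in atTop, D * (log B)⁻¹ * (1 / ((k + 1 : ℕ) : ℝ)) ≤ (μ (E k)).toReal := by
    filter_upwards [(lilL_tendsto hγ1 hx hB).eventually hclt,
      (lilW_tendsto hB).eventually_gt_atTop 0] with k hk hw
    have h1 : (ENNReal.ofReal D) ^ (lilM γ x B k) ≤ μ (E k) := by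
      rw [hE]
      simp only
      rw [lilE_prob X hX hindep hident]
      gcongr
    rw [← ENNReal.ofReal_pow hD0.le, ENNReal.ofReal_le_iff_le_toReal (measure_ne_top _ _)] at h1
    refine le_trans ?_ h1
    have hM : (lilM γ x B k : ℝ) ≤ 2 * (1 - γ) ^ 2 * lilW B k / x ^ 2 + 1 :=
      (Nat.ceil_lt_add_one (by positivity)).le
    have e1 : D * (log B)⁻¹ * (1 / ((k + 1 : ℕ) : ℝ)) = D * Real.exp (- lilW B k) := by
      rw [Real.exp_neg, lilW, Real.log_pow, Real.exp_log (by positivity)]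
      field_simp
    rw [e1, hD, ← Real.exp_add, ← Real.exp_nat_mul]
    apply Real.exp_le_exp.2
    have h2 : (lilM γ x B k : ℝ) * ((1 + γ) * x ^ 2 / 2) ≤
        (2 * (1 - γ) ^ 2 * lilW B k / x ^ 2 + 1) * ((1 + γ) * x ^ 2 / 2) := by gcongr
    have h3 : (2 * (1 - γ) ^ 2 * lilW B k / x ^ 2 + 1) * ((1 + γ) * x ^ 2 / 2) =
        ((1 + γ) * (1 - γ) ^ 2) * lilW B k + (1 + γ) * x ^ 2 / 2 := by
      field_simp
    have h4 : (1 + γ) * (1 - γ) ^ 2 ≤ 1 := by nlinarith [mul_pos hγ hγ]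
    have h5 := mul_le_mul_of_nonneg_right h4 hw.le
    linarith
  have hinf : ∑' k, μ (E k) = ∞ := by
    by_contra hcon
    have hs := ENNReal.summable_toReal hcon
    have hs2 : Summable (fun k : ℕ => D * (log B)⁻¹ * (1 / ((k + 1 : ℕ) : ℝ))) := by
      refine Summable.of_norm_bounded_eventually_nat hs ?_
      filter_upwards [hprob] with k hk
      rwa [Real.norm_of_nonneg (by positivity)]
    rw [summable_mul_left_iff (by positivity)] at hs2
    exact Real.not_summable_one_div_natCast ((summable_nat_add_iff 1).1 hs2)
  have hone := measure_limsup_eq_one hEm' hEi hinf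
  have hae : ∀ᵐ ω ∂μ, ω ∈ limsup E atTop := by
    rw [← prob_compl_eq_zero_iff (MeasurableSet.measurableSet_limsup hEm')] at hone
    exact hone
  filter_upwards [hae, hlow] with ω hω hωl
  rw [mem_limsup_iff_frequently_mem] at hω
  have hBt : Tendsto (fun k : ℕ => B ^ k) atTop atTop := tendsto_pow_atTop_atTop_of_one_lt hB
  have hf := hω.and_eventually ((lil_det hγ hγ1 hx hB hB1 hB2).and (hBt.eventually hωl))
  have hnt : Tendsto (fun k => B ^ k + lilM γ x B k * lilL γ x B k) atTop atTop :=
    tendsto_atTop_mono (fun k => Nat.le_add_right _ _) hBt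
  refine hnt.frequently (hf.mono ?_)
  rintro k ⟨hk, ⟨h1, h2, h3⟩, h4⟩
  have h5 := lilE_sum X _ _ _ _ ω hk
  have h0 : 0 ≤ lilA ((B : ℝ) ^ (k + 1)) := Real.sqrt_nonneg _
  have h6 : (1 - ε) * lilA ((B ^ k + lilM γ x B k * lilL γ x B k : ℕ) : ℝ) ≤
      (1 - ε) * lilA ((B : ℝ) ^ (k + 1)) := by
    apply mul_le_mul_of_nonneg_left h3; linarith
  have h7 : (1 - ε) * lilA ((B : ℝ) ^ (k + 1)) ≤ ((1 - γ) ^ 2 - 2 * γ) * lilA ((B : ℝ) ^ (k + 1)) := by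
    apply mul_le_mul_of_nonneg_right _ h0
    rw [hγdef]; nlinarith
  linarith


theorem lil_anti {s t : ℝ} (hs : Real.exp (Real.exp 1) ≤ s) (hst : s ≤ t) :
    lilA t / t ≤ lilA s / s := by
  have hs0 : 0 < s := (Real.exp_pos _).trans_le hs
  have ht0 : 0 < t := hs0.trans_le hst
  have hls : Real.exp 1 ≤ log s := by rwa [Real.le_log_iff_exp_le hs0]
  have hl2 : log s ≤ log t := Real.log_le_log hs0 hst
  have he : 0 < Real.exp 1 := Real.exp_pos 1
  have he1 : 1 ≤ Real.exp 1 := Real.one_le_exp (by norm_num)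
  have hes : Real.exp 1 ≤ s := le_trans (by have := Real.add_one_le_exp (Real.exp 1); linarith) hs
  have h1 : log t / t ≤ log s / s :=
    Real.log_div_self_antitoneOn hes (hes.trans hst) hst
  have h2 : log (log t) / log t ≤ log (log s) / log s :=
    Real.log_div_self_antitoneOn hls (hls.trans hl2) hl2
  have hlls : 0 ≤ log (log s) := Real.log_nonneg (by linarith)
  have hls0 : 0 < log s := by linarith
  have hlt0 : 0 < log t := by linarith
  have hllt : 0 ≤ log (log t) := Real.log_nonneg (by linarith)
  have h3 : log (log t) / t ≤ log (log s) / s := by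
    have := mul_le_mul h2 h1 (by positivity) (by positivity)
    have e1 : log (log t) / log t * (log t / t) = log (log t) / t := by field_simp
    have e2 : log (log s) / log s * (log s / s) = log (log s) / s := by field_simp
    rwa [e1, e2] at this
  have key : ∀ r : ℝ, 0 < r → lilA r / r = √(2 * (log (log r) / r)) := by
    intro r hr
    rw [lilA, ← Real.sqrt_sq hr.le, ← Real.sqrt_div' _ (by positivity), Real.sqrt_sq hr.le]
    congr 1
    field_simp
  rw [key t ht0, key s hs0]
  gcongr

theorem lil_const {s : ℝ} (hs : Real.exp (Real.exp 1) ≤ s) :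
    0 < lilA s ∧ √s / √(2 * log (log s)) = s / lilA s := by
  have hs0 : 0 < s := (Real.exp_pos _).trans_le hs
  have hls : Real.exp 1 ≤ log s := by rwa [Real.le_log_iff_exp_le hs0]
  have he1 : 1 < Real.exp 1 := Real.one_lt_exp_iff.2 (by norm_num)
  have hlls : 0 < log (log s) := Real.log_pos (by linarith)
  have e : lilA s = √s * √(2 * log (log s)) := by
    rw [lilA, ← Real.sqrt_mul hs0.le]; ring_nf
  have h1 : 0 < √s := Real.sqrt_pos.2 hs0
  have h2 : 0 < √(2 * log (log s)) := Real.sqrt_pos.2 (by positivity)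
  refine ⟨by rw [e]; positivity, ?_⟩
  rw [e]
  rw [div_eq_div_iff h2.ne' (by positivity)]
  linear_combination √(2 * log (log s)) * Real.mul_self_sqrt hs0.le

/-- If `(X i)` are i.i.d. with mean 0, variance 1, and `E|X 0|^p < ∞` for some `p > 2`,
and `M_n = sup{X̄_i : i ≥ n}`, then almost surely
`limsup_{n→∞} (√n / √(2 log log n)) · M_n = 1`. -/
theorem limsup_supSampleMean_LIL
    {Ω : Type*} [MeasureSpace Ω] [IsProbabilityMeasure (ℙ : Measure Ω)]
    (X : ℕ → Ω → ℝ) (hmeas : ∀ i, Measurable (X i))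
    (hindep : iIndepFun X ℙ)
    (hident : ∀ i, IdentDistrib (X i) (X 0) ℙ ℙ)
    (hmean : ∫ ω, X 0 ω ∂ℙ = 0)
    (hvar : variance (X 0) ℙ = 1)
    (p : ℝ) (hp : 2 < p)
    (hmom : Integrable (fun ω => |X 0 ω| ^ p) ℙ)
    (M : ℕ → Ω → ℝ)
    (hM : ∀ n ω, M n ω = ⨆ i : {i : ℕ // n ≤ i}, (∑ j ∈ Finset.range i, X j ω) / i) :
    ∀ᵐ ω ∂ℙ, Filter.limsup
      (fun n : ℕ => Real.sqrt n / Real.sqrt (2 * Real.log (Real.log n)) * M n ω)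
      atTop = 1 := by
  have hL2 : MemLp (X 0) 2 ℙ :=
    memLp_two_of_variance_ne_zero (hmeas 0).aestronglyMeasurable (by rw [hvar]; norm_num)
  have hint : Integrable (X 0) ℙ := hL2.integrable (by norm_num)
  have hint2 : Integrable (fun ω => X 0 ω ^ 2) ℙ := hL2.integrable_sq
  have hvar2 : ∫ ω, X 0 ω ^ 2 ∂ℙ = 1 := by
    rw [← hvar, variance_of_integral_eq_zero (hmeas 0).aemeasurable hmean]
  have hup : ∀ᵐ ω ∂ℙ, ∀ m : ℕ, ∀ᶠ n : ℕ in atTop,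
      ∑ j ∈ Finset.range n, X j ω ≤ (1 + 1 / ((m : ℝ) + 2)) * lilA n :=
    ae_all_iff.2 fun m => lil_upper X hmeas hindep hident hint hint2 hmean hvar2 p hp hmom (by positivity)
  have hlow0 : ∀ᵐ ω ∂ℙ, ∀ᶠ n : ℕ in atTop, - (2 * lilA n) ≤ ∑ j ∈ Finset.range n, X j ω := by
    have h := lil_upper (fun i ω => - X i ω) (fun i => (hmeas i).neg)
      (hindep.comp (fun _ x => -x) (fun _ => measurable_neg))
      (fun i => (hident i).comp measurable_neg) hint.neg (by simpa using hint2)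
      (by rw [integral_neg, hmean, neg_zero]) (by simpa using hvar2) p hp (by simpa using hmom) one_pos
    filter_upwards [h] with ω hω
    filter_upwards [hω] with n hn
    rw [Finset.sum_neg_distrib] at hn
    linarith
  have hlow : ∀ᵐ ω ∂ℙ, ∀ m : ℕ, ∃ᶠ n : ℕ in atTop,
      (1 - 1 / ((m : ℝ) + 2)) * lilA n ≤ ∑ j ∈ Finset.range n, X j ω := by
    refine ae_all_iff.2 fun m => lil_lower X hmeas hindep hident hmean hvar2 hlow0 (by positivity) ?_
    rw [div_lt_one (by positivity)]
    have : (0 : ℝ) ≤ m := Nat.cast_nonneg m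
    linarith
  have hslln := strong_law_ae_real X hint (fun i j hij => hindep.indepFun hij) hident
  filter_upwards [hup, hlow, hslln] with ω h1 h2 h3
  have hbdd : ∀ n, BddAbove (Set.range fun i : {i : ℕ // n ≤ i} =>
      (∑ j ∈ Finset.range i, X j ω) / (i : ℕ)) := by
    intro n
    refine h3.bddAbove_range.mono ?_
    rintro _ ⟨i, rfl⟩
    exact ⟨i, rfl⟩
  have hbig : ∀ᶠ n : ℕ in atTop, Real.exp (Real.exp 1) ≤ (n : ℝ) :=
    tendsto_natCast_atTop_atTop.eventually_ge_atTop _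
  set F : ℕ → ℝ := fun n => √n / √(2 * log (log n)) * M n ω with hF
  have hFu : ∀ m : ℕ, ∀ᶠ n in atTop, F n ≤ 1 + 1 / ((m : ℝ) + 2) := by
    intro m
    filter_upwards [eventually_forall_ge_atTop.2 (h1 m), hbig] with n hn hb
    obtain ⟨hA, hc⟩ := lil_const hb
    have hn0 : 0 < (n : ℝ) := (Real.exp_pos _).trans_le hb
    have hMn : M n ω ≤ (1 + 1 / ((m : ℝ) + 2)) * (lilA n / n) := by
      rw [hM]
      have : Nonempty {i : ℕ // n ≤ i} := ⟨⟨n, le_rfl⟩⟩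
      refine ciSup_le fun i => ?_
      have hi : (n : ℝ) ≤ (i : ℕ) := by exact_mod_cast i.2
      calc _ ≤ (1 + 1 / ((m : ℝ) + 2)) * lilA (i : ℕ) / (i : ℕ) := by
            gcongr
            exact hn i i.2
        _ = (1 + 1 / ((m : ℝ) + 2)) * (lilA (i : ℕ) / (i : ℕ)) := by ring
        _ ≤ _ := by
          gcongr ?_ * ?_
          exact lil_anti hb hi
    rw [hF]
    simp only
    rw [hc]
    calc _ ≤ n / lilA n * ((1 + 1 / ((m : ℝ) + 2)) * (lilA n / n)) := by gcongr
      _ = _ := by field_simp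
  have hFl : ∀ m : ℕ, ∃ᶠ n in atTop, 1 - 1 / ((m : ℝ) + 2) ≤ F n := by
    intro m
    refine ((h2 m).and_eventually hbig).mono ?_
    rintro n ⟨hn, hb⟩
    obtain ⟨hA, hc⟩ := lil_const hb
    have hn0 : 0 < (n : ℝ) := (Real.exp_pos _).trans_le hb
    have hMn : (∑ j ∈ Finset.range n, X j ω) / n ≤ M n ω := by
      rw [hM]
      exact le_ciSup (hbdd n) ⟨n, le_rfl⟩
    rw [hF]
    simp only
    rw [hc]
    calc 1 - 1 / ((m : ℝ) + 2) = n / lilA n * ((1 - 1 / ((m : ℝ) + 2)) * lilA n / n) := by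
          field_simp
      _ ≤ n / lilA n * ((∑ j ∈ Finset.range n, X j ω) / n) := by gcongr
      _ ≤ _ := by gcongr
  have hcob : IsCoboundedUnder (· ≤ ·) atTop F := IsCoboundedUnder.of_frequently_ge (hFl 0)
  have hbd : IsBoundedUnder (· ≤ ·) atTop F := ⟨_, hFu 0⟩
  have hlim : Tendsto (fun m : ℕ => 1 / ((m : ℝ) + 2)) atTop (nhds 0) := by
    simp only [one_div]
    exact tendsto_inv_atTop_zero.comp
      (tendsto_atTop_add_const_right _ _ tendsto_natCast_atTop_atTop)
  apply le_antisymm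
  · refine ge_of_tendsto (x := atTop) (f := fun m : ℕ => 1 + 1 / ((m : ℝ) + 2))
      (by simpa using hlim.const_add 1) (Eventually.of_forall fun m => ?_)
    exact limsup_le_of_le hcob (hFu m)
  · refine le_of_tendsto (x := atTop) (f := fun m : ℕ => 1 - 1 / ((m : ℝ) + 2))
      (by simpa using hlim.const_sub 1) (Eventually.of_forall fun m => ?_)
    exact le_limsup_of_frequently_le (hFl m) hbd
end

section
/- Let (X_i)_{i≥1} be i.i.d. exponential random variables with mean 1, X̄_i := (X_1 + ... + X_i)/i, and Z_n := max{X̄_1, ..., X̄_n}. Then for every α > 0 and every n ∈ ℕ⁺, E[Z_n^α] = α · Σ_{k=1}^{n} Γ(α + k − 1) / (k^α · k!), where Γ is the Gamma function. -/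
open MeasureTheory ProbabilityTheory Real

/-- The event that the walk crosses the line `a + k x` for the first time at step `n + 1`. -/
def crossSet (n : ℕ) (a x : ℝ) : Set (ℕ → ℝ) :=
  {y | (∀ k < n, ∑ j ∈ Finset.range (k + 1), y j ≤ a + (k + 1) * x) ∧
    a + (n + 1) * x < ∑ j ∈ Finset.range (n + 1), y j}

/-- Abel-type polynomials. -/
noncomputable def abelG (x : ℝ) : ℕ → ℝ → ℝ
  | 0, _ => 1
  | (m + 1), a => (a + x) * (a + (m + 2) * x) ^ m / (m + 1).factorial

lemma abelG_deriv (x : ℝ) (n : ℕ) (a : ℝ) :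
    HasDerivAt (abelG x (n + 1)) (abelG x n (a + x)) a := by
  cases n with
  | zero =>
    have : abelG x (0 + 1) = fun a => a + x := by
      funext a; simp [abelG]
    rw [this]
    simpa [abelG] using (hasDerivAt_id a).add_const x
  | succ m =>
    have h1 : HasDerivAt (fun a : ℝ => a + x) 1 a := (hasDerivAt_id a).add_const x
    have h2 : HasDerivAt (fun a : ℝ => a + (((m + 1 : ℕ) : ℝ) + 2) * x) 1 a :=
      (hasDerivAt_id a).add_const _
    have h3 := (h1.mul (h2.pow (m + 1))).div_const ((m + 1 + 1).factorial : ℝ)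
    refine (h3.congr_deriv ?_)
    simp only [abelG, Nat.factorial_succ]
    have : ((m.factorial : ℕ) : ℝ) ≠ 0 := by positivity
    push_cast
    have h4 : (m : ℝ) + 1 ≠ 0 := by positivity
    have h5 : (m : ℝ) + 1 + 1 ≠ 0 := by positivity
    field_simp
    simp
    ring

lemma abelG_nonneg {x : ℝ} (hx : 0 ≤ x) (n : ℕ) {a : ℝ} (ha : 0 ≤ a) : 0 ≤ abelG x n a := by
  cases n with
  | zero => simp [abelG]
  | succ m => simp only [abelG]; positivity

lemma abelG_cont (x : ℝ) (n : ℕ) : Continuous (abelG x n) := by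
  cases n with
  | zero => exact continuous_const
  | succ m =>
    have : abelG x (m + 1) = fun a => (a + x) * (a + (m + 2) * x) ^ m / (m + 1).factorial := rfl
    rw [this]; fun_prop

lemma abelG_integral (x a : ℝ) (n : ℕ) :
    ∫ t in (0 : ℝ)..(a + x), abelG x n (a + x - t) = abelG x (n + 1) a := by
  have h : ∀ t ∈ Set.uIcc (0 : ℝ) (a + x),
      HasDerivAt (fun t => - abelG x (n + 1) (a - t)) (abelG x n (a + x - t)) t := by
    intro t _
    have h1 : HasDerivAt (fun t : ℝ => a - t) (-1) t := by
      simpa using (hasDerivAt_id t).const_sub a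
    have h2 := ((abelG_deriv x n (a - t)).comp t h1).neg
    refine h2.congr_deriv ?_
    rw [show a - t + x = a + x - t by ring]; ring
  rw [intervalIntegral.integral_eq_sub_of_hasDerivAt h]
  · simp [abelG]
  · exact ((abelG_cont x n).comp (by fun_prop)).intervalIntegrable _ _

lemma expMeasure_eq : expMeasure 1 = volume.withDensity (exponentialPDF 1) := rfl

lemma expMeasure_Ioi {c : ℝ} (hc : 0 ≤ c) :
    expMeasure 1 (Set.Ioi c) = ENNReal.ofReal (exp (-c)) := by
  have := isProbabilityMeasure_expMeasure (r := 1) one_pos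
  rw [← Set.compl_Iic, prob_compl_eq_one_sub measurableSet_Iic, expMeasure_eq,
    withDensity_apply _ measurableSet_Iic, lintegral_exponentialPDF_eq_antiDeriv one_pos, if_pos hc,
    ← ENNReal.ofReal_one, ← ENNReal.ofReal_sub]
  · congr 1; simp
  · simp [hc]

lemma expMeasure_Iio : expMeasure 1 (Set.Iio 0) = 0 := by
  rw [expMeasure_eq, withDensity_apply _ measurableSet_Iio]
  exact lintegral_exponentialPDF_of_nonpos le_rfl

lemma lintegral_expMeasure {c : ℝ} (hc : 0 ≤ c) (f : ℝ → ℝ) (hf : Continuous f)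
    (hf0 : ∀ t ∈ Set.Icc 0 c, 0 ≤ f t) :
    ∫⁻ t, (Set.Iic c).indicator (fun t => ENNReal.ofReal (f t)) t ∂(expMeasure 1)
      = ENNReal.ofReal (∫ t in (0 : ℝ)..c, exp (-t) * f t) := by
  have hm : Measurable (exponentialPDF 1) :=
    (measurable_exponentialPDFReal 1).ennreal_ofReal
  rw [expMeasure_eq, lintegral_withDensity_eq_lintegral_mul _ hm
    ((hf.measurable.ennreal_ofReal).indicator measurableSet_Iic),
    intervalIntegral.integral_of_le hc, ← integral_Icc_eq_integral_Ioc,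
    ofReal_integral_eq_lintegral_ofReal]
  · rw [← lintegral_indicator measurableSet_Icc]
    congr 1
    funext t
    simp only [Pi.mul_apply, Set.indicator_apply, Set.mem_Iic, Set.mem_Icc]
    by_cases h0 : 0 ≤ t
    · by_cases h1 : t ≤ c
      · simp only [h0, h1, and_self, if_true]
        rw [exponentialPDF_of_nonneg h0, ← ENNReal.ofReal_mul (by positivity)]
        simp
      · simp [h1]
    · simp [h0, exponentialPDF_of_neg (not_le.mp h0)]
  · exact (Continuous.integrableOn_Icc (by fun_prop))
  · filter_upwards [ae_restrict_mem measurableSet_Icc] with t ht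
    exact mul_nonneg (exp_pos _).le (hf0 t ht)

lemma measurableSet_crossSet (n : ℕ) (x : ℝ) :
    MeasurableSet {p : ℝ × (ℕ → ℝ) | p.2 ∈ crossSet n p.1 x} := by
  have : {p : ℝ × (ℕ → ℝ) | p.2 ∈ crossSet n p.1 x} =
    (⋂ k ∈ Finset.range n,
      {p : ℝ × (ℕ → ℝ) | ∑ j ∈ Finset.range (k + 1), p.2 j ≤ p.1 + (k + 1) * x}) ∩
    {p : ℝ × (ℕ → ℝ) | p.1 + (n + 1) * x < ∑ j ∈ Finset.range (n + 1), p.2 j} := by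
    ext p; simp [crossSet]
  rw [this]
  refine MeasurableSet.inter (Finset.measurableSet_biInter _ fun k _ => ?_) ?_
  · exact measurableSet_le (by fun_prop) (by fun_prop)
  · exact measurableSet_lt (by fun_prop) (by fun_prop)

lemma measurableSet_crossSet' (n : ℕ) (a x : ℝ) : MeasurableSet (crossSet n a x) :=
  (measurable_prodMk_left (x := a)) (measurableSet_crossSet n x)

lemma crossSet_succ (n : ℕ) (a x : ℝ) (y : ℕ → ℝ) :
    y ∈ crossSet (n + 1) a x ↔
      y 0 ≤ a + x ∧ (fun i => y (i + 1)) ∈ crossSet n (a + x - y 0) x := by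
  simp only [crossSet, Set.mem_ofPred_eq]
  rw [Finset.sum_range_succ' _ (n + 1)]
  constructor
  · rintro ⟨h1, h2⟩
    refine ⟨by simpa using h1 0 (by omega), fun k hk => ?_, ?_⟩
    · have := h1 (k + 1) (by omega)
      rw [Finset.sum_range_succ' _ (k + 1)] at this
      push_cast at this
      linarith
    · push_cast at h2; linarith
  · rintro ⟨h0, h1, h2⟩
    refine ⟨fun k hk => ?_, ?_⟩
    · cases k with
      | zero => simpa using h0
      | succ k =>
        have := h1 k (by omega)
        rw [Finset.sum_range_succ' _ (k + 1)]
        push_cast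
        linarith
    · push_cast; linarith

lemma indep_head_tail {Ω : Type*} [MeasurableSpace Ω] {P : Measure Ω}
    (X : ℕ → Ω → ℝ) (hmeas : ∀ i, Measurable (X i)) (hindep : iIndepFun X P) :
    IndepFun (X 0) (fun ω i => X (i + 1) ω) P := by
  have h := indep_iSup_of_disjoint (fun i => (hmeas i).comap_le) hindep.iIndep
    (S := {0}) (T := Set.Ici 1) (by simp)
  rw [IndepFun_iff_Indep]
  refine indep_of_indep_of_le_left (indep_of_indep_of_le_right h ?_) ?_
  · rw [MeasurableSpace.pi, MeasurableSpace.comap_iSup]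
    refine iSup_le fun i => ?_
    rw [MeasurableSpace.comap_comp]
    exact le_iSup₂_of_le (i + 1) (by simp) le_rfl
  · exact le_iSup₂_of_le 0 (by simp) le_rfl

lemma prob_crossSet {Ω : Type*} [MeasurableSpace Ω] {P : Measure Ω} [IsProbabilityMeasure P]
    {x : ℝ} (hx : 0 ≤ x) (n : ℕ) :
    ∀ (X : ℕ → Ω → ℝ) (_ : ∀ i, Measurable (X i)) (_ : iIndepFun X P)
    (_ : ∀ i, Measure.map (X i) P = expMeasure 1) (a : ℝ) (_ : 0 ≤ a),
    P {ω | (fun i => X i ω) ∈ crossSet n a x}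
      = ENNReal.ofReal (exp (-(a + (n + 1) * x)) * abelG x n a) := by
  induction n with
  | zero =>
    intro X hmeas hindep hdist a ha
    have : {ω | (fun i => X i ω) ∈ crossSet 0 a x} = X 0 ⁻¹' Set.Ioi (a + x) := by
      ext ω; simp [crossSet]
    rw [this, ← Measure.map_apply (hmeas 0) measurableSet_Ioi, hdist,
      expMeasure_Ioi (by positivity)]
    simp [abelG]
  | succ n ih =>
    intro X hmeas hindep hdist a ha
    have := isProbabilityMeasure_expMeasure (r := 1) one_pos
    set Y : Ω → ℕ → ℝ := fun ω i => X (i + 1) ω with hY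
    have hYm : Measurable Y := measurable_pi_iff.2 fun i => hmeas (i + 1)
    have hmap := (indep_head_tail X hmeas hindep).map_prod_eq_prod_map_map
      (hmeas 0).aemeasurable hYm.aemeasurable
    have ih' := ih (fun i => X (i + 1)) (fun i => hmeas _)
      (hindep.precomp (g := fun i => i + 1) (fun i j h => by simpa using h)) (fun i => hdist _)
    set A : Set (ℝ × (ℕ → ℝ)) := {p | p.1 ≤ a + x ∧ p.2 ∈ crossSet n (a + x - p.1) x} with hA
    have hAm : MeasurableSet A := by
      refine MeasurableSet.inter (s₁ := {p : ℝ × (ℕ → ℝ) | p.1 ≤ a + x})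
        (measurableSet_le (by fun_prop) (by fun_prop)) ?_
      exact (show Measurable (fun p : ℝ × (ℕ → ℝ) => ((a + x - p.1, p.2) : ℝ × (ℕ → ℝ)))
        by fun_prop) (measurableSet_crossSet n x)
    have hev : {ω | (fun i => X i ω) ∈ crossSet (n + 1) a x} =
        (fun ω => (X 0 ω, Y ω)) ⁻¹' A := by
      ext ω; simp only [Set.mem_ofPred_eq, crossSet_succ, hA, Set.mem_preimage, hY]
    have : IsProbabilityMeasure (P.map Y) := Measure.isProbabilityMeasure_map hYm.aemeasurable
    rw [hev, ← Measure.map_apply ((hmeas 0).prodMk hYm) hAm, hmap, hdist,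
      Measure.prod_apply hAm]
    have hsec : ∀ t, (P.map Y) (Prod.mk t ⁻¹' A) = (Set.Iic (a + x)).indicator
        (fun t => ENNReal.ofReal (exp (-((a + x - t) + (n + 1) * x)) * abelG x n (a + x - t))) t := by
      intro t
      by_cases ht : t ≤ a + x
      · have : Prod.mk t ⁻¹' A = crossSet n (a + x - t) x := by
          ext y; simp [hA, ht]
        rw [Set.indicator_of_mem (by simpa using ht), this,
          Measure.map_apply hYm (measurableSet_crossSet' _ _ _), ← ih' _ (by linarith)]
        rfl
      · have : Prod.mk t ⁻¹' A = ∅ := by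
          ext y; simp [hA, ht]
        rw [Set.indicator_of_notMem (by simpa using ht), this, measure_empty]
    simp_rw [hsec]
    rw [lintegral_expMeasure (by positivity)]
    · congr 1
      rw [← abelG_integral, ← intervalIntegral.integral_const_mul]
      congr 1
      funext t
      rw [← mul_assoc, ← exp_add]
      congr 2
      push_cast; ring
    · have := abelG_cont x n
      fun_prop
    · intro t ht
      exact mul_nonneg (exp_pos _).le (abelG_nonneg hx n (by linarith [ht.2]))

lemma abelG_zero (x : ℝ) (n : ℕ) :
    abelG x n 0 = ((n + 1 : ℕ) : ℝ) ^ n * x ^ n / (n + 1).factorial := by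
  cases n with
  | zero => simp [abelG]
  | succ m =>
    simp only [abelG, Nat.factorial_succ]
    have : ((m.factorial : ℕ) : ℝ) ≠ 0 := by positivity
    push_cast
    have h4 : (m : ℝ) + 1 ≠ 0 := by positivity
    have h5 : (m : ℝ) + 1 + 1 ≠ 0 := by positivity
    field_simp
    rw [show (0 : ℝ) + x * (m + 2) = (m + 1 + 1) * x by ring]
    rw [mul_pow]
    ring

lemma event_eq (n : ℕ) (hn : 1 ≤ n) (t : ℝ) (y : ℕ → ℝ) :
    (t < (Finset.Icc 1 n).sup' (Finset.nonempty_Icc.mpr hn)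
        (fun i => (∑ j ∈ Finset.range i, y j) / i)) ↔
      ∃ k ∈ Finset.range n, y ∈ crossSet k 0 t := by
  classical
  have key : ∀ k : ℕ, t < (∑ j ∈ Finset.range (k + 1), y j) / ((k + 1 : ℕ) : ℝ) ↔
      0 + (k + 1) * t < ∑ j ∈ Finset.range (k + 1), y j := by
    intro k
    rw [lt_div_iff₀ (by positivity)]
    push_cast
    rw [zero_add, mul_comm]
  rw [Finset.lt_sup'_iff]
  constructor
  · rintro ⟨i, hi, h⟩
    rw [Finset.mem_Icc] at hi
    obtain ⟨k, rfl⟩ : ∃ k, i = k + 1 := ⟨i - 1, by omega⟩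
    have hex : ∃ k : ℕ, 0 + (k + 1) * t < ∑ j ∈ Finset.range (k + 1), y j := ⟨k, (key k).1 h⟩
    refine ⟨Nat.find hex, ?_, ?_, Nat.find_spec hex⟩
    · rw [Finset.mem_range]
      have := Nat.find_min' hex ((key k).1 h)
      omega
    · intro m hm
      exact not_lt.mp (Nat.find_min hex hm)
  · rintro ⟨k, hk, -, h⟩
    rw [Finset.mem_range] at hk
    exact ⟨k + 1, Finset.mem_Icc.2 ⟨by omega, by omega⟩, (key k).2 h⟩

lemma crossSet_disj (t : ℝ) {k l : ℕ} (hkl : k < l) (y : ℕ → ℝ) (hk : y ∈ crossSet k 0 t)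
    (hl : y ∈ crossSet l 0 t) : False :=
  absurd hk.2 (not_lt.mpr (hl.1 k hkl))

lemma gamma_term (α : ℝ) (hα : 0 < α) (k : ℕ) :
    ∫⁻ t in Set.Ioi (0 : ℝ), ENNReal.ofReal (exp (-(0 + (k + 1) * t)) * abelG t k 0) *
        ENNReal.ofReal (t ^ (α - 1))
      = ENNReal.ofReal (Real.Gamma (α + (k + 1 : ℕ) - 1) /
          (((k + 1 : ℕ) : ℝ) ^ α * Nat.factorial (k + 1))) := by
  have hk : (0 : ℝ) < ((k + 1 : ℕ) : ℝ) := by positivity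
  have hak : 0 < α + k := by positivity
  have hI := integral_rpow_mul_exp_neg_mul_Ioi hak hk
  have hint : IntegrableOn (fun t : ℝ => t ^ (α + k - 1) * exp (-(((k + 1 : ℕ) : ℝ) * t)))
      (Set.Ioi 0) := by
    by_contra h
    rw [integral_undef h] at hI
    have : 0 < (1 / ((k + 1 : ℕ) : ℝ)) ^ (α + k) * Real.Gamma (α + k) :=
      mul_pos (by positivity) (Real.Gamma_pos_of_pos hak)
    linarith
  set C : ℝ := ((k + 1 : ℕ) : ℝ) ^ k / (k + 1).factorial with hC
  have hC0 : 0 ≤ C := by positivity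
  have hcongr : ∫⁻ t in Set.Ioi (0 : ℝ), ENNReal.ofReal (exp (-(0 + (k + 1) * t)) * abelG t k 0) *
        ENNReal.ofReal (t ^ (α - 1)) = ∫⁻ t in Set.Ioi (0 : ℝ),
        ENNReal.ofReal (C * (t ^ (α + k - 1) * exp (-(((k + 1 : ℕ) : ℝ) * t)))) := by
    refine setLIntegral_congr_fun measurableSet_Ioi fun t ht => ?_
    have ht' : 0 < t := ht
    rw [← ENNReal.ofReal_mul (mul_nonneg (exp_pos _).le (abelG_nonneg ht'.le k le_rfl)), abelG_zero]
    congr 1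
    rw [show α + k - 1 = (α - 1) + k by ring, rpow_add ht', rpow_natCast, hC]
    push_cast
    rw [zero_add]
    ring
  rw [hcongr, ← ofReal_integral_eq_lintegral_ofReal (hint.const_mul C)]
  · rw [integral_const_mul, hI]
    congr 1
    rw [show α + ((k + 1 : ℕ) : ℝ) - 1 = α + k by push_cast; ring, hC, one_div,
      inv_rpow hk.le, rpow_add hk, rpow_natCast]
    have : ((k + 1 : ℕ) : ℝ) ^ α ≠ 0 := by positivity
    field_simp
  · filter_upwards [ae_restrict_mem measurableSet_Ioi] with t ht
    have ht' : 0 < t := ht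
    simp only [Pi.zero_apply]
    positivity

/-- If `(X i)` are i.i.d. exponential random variables with mean 1 and
`Z_n = max{X̄_1, …, X̄_n}`, then for every `α > 0` and `n ≥ 1`,
`E[Z_n^α] = α · ∑_{k=1}^n Γ(α + k - 1) / (k^α · k!)`. -/
theorem moment_maxSampleMean_exponential
    {Ω : Type*} [MeasureSpace Ω] [IsProbabilityMeasure (ℙ : Measure Ω)]
    (X : ℕ → Ω → ℝ) (hmeas : ∀ i, Measurable (X i))
    (hindep : iIndepFun X ℙ)
    (hdist : ∀ i, Measure.map (X i) ℙ = expMeasure 1)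
    (α : ℝ) (hα : 0 < α) (n : ℕ) (hn : 1 ≤ n) :
    ∫ ω, ((Finset.Icc 1 n).sup' (Finset.nonempty_Icc.mpr hn)
        (fun i => (∑ j ∈ Finset.range i, X j ω) / i)) ^ α ∂ℙ
      = α * ∑ k ∈ Finset.Icc 1 n,
          Real.Gamma (α + k - 1) / ((k : ℝ) ^ α * Nat.factorial k) := by
  set Z : Ω → ℝ := fun ω => (Finset.Icc 1 n).sup' (Finset.nonempty_Icc.mpr hn)
        (fun i => (∑ j ∈ Finset.range i, X j ω) / i) with hZ
  have hZm : Measurable Z := by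
    have h := Finset.measurable_sup' (Finset.nonempty_Icc.mpr hn)
      (f := fun (i : ℕ) (ω : Ω) => (∑ j ∈ Finset.range i, X j ω) / (i : ℝ))
      (fun i _ => (Finset.measurable_fun_sum _ fun j _ => hmeas j).div_const _)
    convert h using 1
    funext ω
    rw [Finset.sup'_apply]
  have hXm : Measurable (fun ω i => X i ω) := measurable_pi_iff.2 hmeas
  have hZ0 : 0 ≤ᵐ[ℙ] Z := by
    have h0 : ∀ᵐ ω ∂(ℙ : Measure Ω), 0 ≤ X 0 ω := by
      have := expMeasure_Iio
      rw [← hdist 0, Measure.map_apply (hmeas 0) measurableSet_Iio] at this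
      rw [ae_iff]
      convert this using 2
      ext ω; simp
    filter_upwards [h0] with ω hω
    refine le_trans ?_ (Finset.le_sup' _ (Finset.mem_Icc.2 ⟨le_rfl, hn⟩))
    simpa using hω
  have hP : ∀ t ∈ Set.Ioi (0 : ℝ), (ℙ : Measure Ω) {ω | t < Z ω} =
      ∑ k ∈ Finset.range n, ENNReal.ofReal (exp (-(0 + (k + 1) * t)) * abelG t k 0) := by
    intro t ht
    have : {ω | t < Z ω} =
        ⋃ k ∈ Finset.range n, {ω | (fun i => X i ω) ∈ crossSet k 0 t} := by
      ext ω
      have := event_eq n hn t (fun i => X i ω)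
      simp only [Set.mem_iUnion, Set.mem_ofPred_eq, exists_prop]
      exact this
    rw [this, measure_biUnion_finset]
    · exact Finset.sum_congr rfl fun k _ =>
        prob_crossSet (le_of_lt ht) k X hmeas hindep hdist 0 le_rfl
    · intro k _ l _ hkl
      refine Set.disjoint_left.2 fun ω h1 h2 => ?_
      rcases lt_or_gt_of_ne hkl with h | h
      · exact crossSet_disj t h _ h1 h2
      · exact crossSet_disj t h _ h2 h1
    · exact fun k _ => hXm (measurableSet_crossSet' _ _ _)
  have hl := lintegral_rpow_eq_lintegral_meas_lt_mul (ℙ : Measure Ω) hZ0 hZm.aemeasurable hα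
  have hl2 : ∫⁻ t in Set.Ioi (0 : ℝ), (ℙ : Measure Ω) {ω | t < Z ω} * ENNReal.ofReal (t ^ (α - 1))
      = ∑ k ∈ Finset.range n, ENNReal.ofReal (Real.Gamma (α + (k + 1 : ℕ) - 1) /
          (((k + 1 : ℕ) : ℝ) ^ α * Nat.factorial (k + 1))) := by
    rw [setLIntegral_congr_fun (g := fun t => ∑ k ∈ Finset.range n,
      ENNReal.ofReal (exp (-(0 + (k + 1) * t)) * abelG t k 0) * ENNReal.ofReal (t ^ (α - 1)))
      measurableSet_Ioi (fun t ht => by simp only [hP t ht, Finset.sum_mul])]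
    rw [lintegral_finsetSum]
    · exact Finset.sum_congr rfl fun k _ => gamma_term α hα k
    · intro k _
      have : Measurable fun t : ℝ => abelG t k 0 := by
        simp_rw [abelG_zero]; fun_prop
      fun_prop
  have hterm : ∀ k : ℕ, 0 ≤ Real.Gamma (α + (k + 1 : ℕ) - 1) /
          (((k + 1 : ℕ) : ℝ) ^ α * Nat.factorial (k + 1)) := by
    intro k
    have : 0 < Real.Gamma (α + (k + 1 : ℕ) - 1) := Real.Gamma_pos_of_pos (by push_cast; linarith [(Nat.cast_nonneg k : (0:ℝ) ≤ k)])
    positivity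
  rw [hl2, ← ENNReal.ofReal_sum_of_nonneg (fun k _ => hterm k), ← ENNReal.ofReal_mul hα.le] at hl
  rw [integral_eq_lintegral_of_nonneg_ae (by filter_upwards [hZ0] with ω h using rpow_nonneg h _)
    (hZm.pow_const α).aestronglyMeasurable, hl, ENNReal.toReal_ofReal
      (mul_nonneg hα.le (Finset.sum_nonneg fun k _ => hterm k))]
  congr 1
  rw [Finset.range_eq_Ico, Finset.sum_Ico_add' (fun k : ℕ => Real.Gamma (α + k - 1) / ((k : ℝ) ^ α * Nat.factorial k)) 0 n 1]
  rfl
end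

section
/- Let (X_i)_{i≥1} be i.i.d. exponential random variables with mean 1 and Z_∞ := sup{X̄_i : i ∈ ℕ⁺}. Then E[Z_∞] = π²/6 and Var(Z_∞) = (π²/6)(2 − π²/6). -/
open MeasureTheory ProbabilityTheory Real

theorem lintegral_expMeasure_one (f : ℝ → ENNReal) (hf : Measurable f) :
    ∫⁻ s, f s ∂(expMeasure 1) = ∫⁻ s in Set.Ioi 0, ENNReal.ofReal (exp (-s)) * f s := by
  have h1 : expMeasure 1 = volume.withDensity (exponentialPDF 1) := rfl
  have h2 : Measurable (exponentialPDF 1) := (measurable_exponentialPDFReal 1).ennreal_ofReal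
  rw [h1, lintegral_withDensity_eq_lintegral_mul _ h2 hf, ← setLIntegral_congr Ioi_ae_eq_Ici.symm,
    ← lintegral_indicator measurableSet_Ici]
  congr 1
  ext s
  by_cases hs : 0 ≤ s
  · simp [Set.indicator, hs, exponentialPDF_of_nonneg hs]
  · simp [Set.indicator, hs, exponentialPDF_of_neg (not_le.1 hs)]

theorem lintegral_gamma_kernel {a r : ℝ} (ha : 0 < a) (hr : 0 < r) :
    ∫⁻ t in Set.Ioi 0, ENNReal.ofReal (t ^ (a - 1) * exp (-(r * t)))
      = ENNReal.ofReal ((1 / r) ^ a * Gamma a) := by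
  have h := integral_rpow_mul_exp_neg_mul_Ioi ha hr
  have hpos : 0 < (1 / r) ^ a * Gamma a := by
    have := Gamma_pos_of_pos ha
    positivity
  rw [← h, ofReal_integral_eq_lintegral_ofReal]
  · exact not_imp_comm.1 integral_undef (by rw [h]; exact hpos.ne')
  · filter_upwards [ae_restrict_mem measurableSet_Ioi] with t ht
    have : (0:ℝ) < t := ht
    simp only [Pi.zero_apply]
    positivity

theorem expMeasure_one_Ioi {a : ℝ} (ha : 0 ≤ a) :
    expMeasure 1 (Set.Ioi a) = ENNReal.ofReal (exp (-a)) := by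
  have h := lintegral_expMeasure_one ((Set.Ioi a).indicator 1)
    (measurable_one.indicator measurableSet_Ioi)
  rw [lintegral_indicator_one measurableSet_Ioi] at h
  rw [h, ← integral_exp_neg_Ioi a, ofReal_integral_eq_lintegral_ofReal]
  · rw [← lintegral_indicator measurableSet_Ioi, ← lintegral_indicator measurableSet_Ioi]
    congr 1
    ext s
    by_cases hs : a < s
    · have : 0 < s := by linarith
      simp [Set.indicator, hs, this]
    · simp [Set.indicator, hs]
  · exact not_imp_comm.1 integral_undef (by rw [integral_exp_neg_Ioi]; exact (exp_pos _).ne')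
  · exact Filter.Eventually.of_forall fun t => (exp_pos _).le

/-- First crossing of the barrier `u + (i+1) x` by the partial sums happens at index `n`. -/
def crossEv (x : ℝ) : ℕ → ℝ → (ℕ → ℝ) → Prop
  | 0, u, s => u + x < s 0
  | n + 1, u, s => s 0 ≤ u + x ∧ crossEv x n (u + x - s 0) (fun i => s (i + 1))

theorem crossEv_iff (x : ℝ) (n : ℕ) : ∀ (u : ℝ) (s : ℕ → ℝ), crossEv x n u s ↔
    ((∀ i < n, ∑ j ∈ Finset.range (i + 1), s j ≤ u + (i + 1) * x) ∧
      u + (n + 1) * x < ∑ j ∈ Finset.range (n + 1), s j) := by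
  induction n with
  | zero => intro u s; simp [crossEv]
  | succ n ih =>
    intro u s
    rw [crossEv, ih, Finset.sum_range_succ' s (n + 1)]
    constructor
    · rintro ⟨h0, h1, h2⟩
      refine ⟨?_, by push_cast at *; linarith⟩
      intro i hi
      cases i with
      | zero => simpa using h0
      | succ i =>
        have := h1 i (by omega)
        rw [Finset.sum_range_succ' s (i + 1)]
        push_cast
        linarith
    · rintro ⟨h1, h2⟩
      refine ⟨by simpa using h1 0 (by omega), ?_, by push_cast at *; linarith⟩
      intro i hi
      have := h1 (i + 1) (by omega)
      rw [Finset.sum_range_succ' s (i + 1)] at this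
      push_cast at this
      linarith

theorem measurable_crossEv (x : ℝ) (n : ℕ) :
    MeasurableSet {p : ℝ × (ℕ → ℝ) | crossEv x n p.1 p.2} := by
  simp only [crossEv_iff, measurableSet_setOfPred]
  have (i : ℕ) : Measurable fun p : ℝ × (ℕ → ℝ) => ∑ j ∈ Finset.range (i + 1), p.2 j := by fun_prop
  refine Measurable.and (Measurable.forall fun i => Measurable.forall fun _ => ?_) ?_
  · exact measurableSet_setOfPred.1 (measurableSet_le (this i) (by fun_prop))
  · exact measurableSet_setOfPred.1 (measurableSet_lt (by fun_prop) (this n))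

/-- The Abel-Goncharov type polynomials. -/
noncomputable def gPoly (x : ℝ) : ℕ → ℝ → ℝ
  | 0, _ => 1
  | n + 1, u => (u + x) * (u + (n + 2) * x) ^ n / (n + 1).factorial

theorem hasDerivAt_gPoly (x : ℝ) (n : ℕ) (u : ℝ) :
    HasDerivAt (gPoly x (n + 1)) (gPoly x n (u + x)) u := by
  have h1 : HasDerivAt (fun u : ℝ => u + x) 1 u := (hasDerivAt_id u).add_const x
  have h2 : HasDerivAt (fun u : ℝ => u + (n + 2) * x) 1 u := (hasDerivAt_id u).add_const _
  have h := (h1.mul (h2.pow n)).div_const ((n + 1).factorial : ℝ)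
  refine HasDerivAt.congr_deriv (f := gPoly x (n + 1)) h ?_
  cases n with
  | zero => simp [gPoly]
  | succ n =>
    simp only [gPoly, Nat.factorial_succ (n + 1), Pi.pow_apply]
    have : ((n + 1).factorial : ℝ) ≠ 0 := by positivity
    push_cast
    field_simp
    ring_nf

theorem gPoly_nonneg {x : ℝ} (hx : 0 ≤ x) (n : ℕ) {u : ℝ} (hu : 0 ≤ u + x) : 0 ≤ gPoly x n u := by
  cases n with
  | zero => simp [gPoly]
  | succ n =>
    have : 0 ≤ u + (n + 2) * x := by nlinarith [mul_nonneg n.cast_nonneg hx]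
    simp only [gPoly]
    positivity

theorem gPoly_cont (x : ℝ) (n : ℕ) : Continuous (gPoly x n) := by
  cases n with
  | zero => exact continuous_const
  | succ n => 
    show Continuous fun u : ℝ => (u + x) * (u + (n + 2) * x) ^ n / (n + 1).factorial
    fun_prop

theorem indep_tail {Ω : Type*} [MeasurableSpace Ω] {μ : Measure Ω}
    (X : ℕ → Ω → ℝ) (hmeas : ∀ i, Measurable (X i)) (hindep : iIndepFun X μ) :
    IndepFun (X 0) (fun ω i => X (i + 1) ω) μ := by
  have h := indep_iSup_of_disjoint (m := fun i => (inferInstance : MeasurableSpace ℝ).comap (X i))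
    (fun i => (hmeas i).comap_le) hindep.iIndep (S := {0}) (T := {i | 0 < i}) (by simp)
  rw [IndepFun_iff_Indep]
  refine indep_of_indep_of_le_left (indep_of_indep_of_le_right h ?_) ?_
  · rw [MeasurableSpace.pi, MeasurableSpace.comap_iSup]
    refine iSup_le fun i => ?_
    rw [MeasurableSpace.comap_comp]
    exact le_iSup₂_of_le (i + 1) (by simp) le_rfl
  · simp

theorem prob_crossEv {x : ℝ} (hx : 0 ≤ x) (n : ℕ) :
    ∀ {Ω : Type*} [MeasurableSpace Ω] {μ : Measure Ω} [IsProbabilityMeasure μ]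
    (X : ℕ → Ω → ℝ) (_ : ∀ i, Measurable (X i)) (_ : iIndepFun X μ)
    (_ : ∀ i, Measure.map (X i) μ = expMeasure 1) (u : ℝ) (_ : 0 ≤ u + x),
    μ {ω | crossEv x n u (fun i => X i ω)} =
      ENNReal.ofReal (exp (-(u + (n + 1) * x)) * gPoly x n u) := by
  induction n with
  | zero =>
    intro Ω _ μ _ X hm hi hd u hu
    have := expMeasure_one_Ioi hu
    rw [← hd 0, Measure.map_apply (hm 0) measurableSet_Ioi] at this
    simpa [crossEv, gPoly, Set.preimage, Set.mem_Ioi] using this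
  | succ n ih =>
    intro Ω _ μ _ X hm hi hd u hu
    have hp := (indep_tail X hm hi).map_prod_eq_prod_map_map (hm 0).aemeasurable
      (by fun_prop)
    set E : Set (ℝ × (ℕ → ℝ)) := {p | p.1 ≤ u + x ∧ crossEv x n (u + x - p.1) p.2} with hE
    have hEm : MeasurableSet E := by
      refine MeasurableSet.inter (s₁ := {p : ℝ × (ℕ → ℝ) | p.1 ≤ u + x})
        (measurableSet_le (by fun_prop) (by fun_prop)) ?_
      have hg : Measurable fun p : ℝ × (ℕ → ℝ) => (u + x - p.1, p.2) := by fun_prop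
      exact hg (measurable_crossEv x n)
    have e1 : μ {ω | crossEv x (n + 1) u (fun i => X i ω)} =
        (μ.map (fun ω => (X 0 ω, fun i => X (i + 1) ω))) E := by
      rw [Measure.map_apply (by fun_prop) hEm]
      rfl
    have : IsProbabilityMeasure (μ.map (fun ω i => X (i + 1) ω)) :=
      Measure.isProbabilityMeasure_map (by fun_prop)
    rw [e1, hp, Measure.prod_apply hEm, hd 0,
      lintegral_expMeasure_one _ (measurable_measure_prodMk_left hEm)]
    have e2 : ∀ s : ℝ, (μ.map (fun ω i => X (i + 1) ω)) (Prod.mk s ⁻¹' E) =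
        (Set.Iic (u + x)).indicator (fun s => ENNReal.ofReal
          (exp (-(u + x - s + (n + 1) * x)) * gPoly x n (u + x - s))) s := by
      intro s
      rw [Measure.map_apply (by fun_prop) (measurable_prodMk_left hEm)]
      by_cases hs : s ≤ u + x
      · rw [Set.indicator_of_mem (by exact hs)]
        rw [← ih (fun i => X (i + 1)) (fun i => hm _) (hi.precomp (add_left_injective 1))
          (fun i => hd _) (u + x - s) (by linarith)]
        congr 1
        ext ω
        simp [hE, hs]
      · rw [Set.indicator_of_notMem (by exact hs)]
        convert measure_empty (μ := μ)
        ext ω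
        simp [hE, hs]
    simp_rw [e2]
    set c := exp (-(u + ((n + 1 : ℕ) + 1) * x)) with hc
    have e3 : ∫⁻ s in Set.Ioi 0, ENNReal.ofReal (exp (-s)) *
        (Set.Iic (u + x)).indicator (fun s => ENNReal.ofReal
          (exp (-(u + x - s + (n + 1) * x)) * gPoly x n (u + x - s))) s =
        ∫⁻ s in Set.Ioc 0 (u + x), ENNReal.ofReal (c * gPoly x n (u - s + x)) := by
      rw [← lintegral_indicator measurableSet_Ioi, ← lintegral_indicator measurableSet_Ioc]
      congr 1
      ext s
      by_cases h0 : 0 < s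
      · by_cases hs : s ≤ u + x
        · simp only [Set.indicator, Set.mem_Ioi, h0, Set.mem_Iic, hs, Set.mem_Ioc, and_self, if_true]
          rw [← ENNReal.ofReal_mul (exp_pos _).le, ← mul_assoc, ← exp_add, hc]
          push_cast
          ring_nf
        · simp [Set.indicator, hs]
      · simp [Set.indicator, h0]
    rw [e3, ← ofReal_integral_eq_lintegral_ofReal, ← intervalIntegral.integral_of_le hu]
    · congr 1
      have hd : ∀ s ∈ Set.uIcc 0 (u + x), HasDerivAt (fun s => -(c * gPoly x (n + 1) (u - s)))
          (c * gPoly x n (u - s + x)) s := by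
        intro s _
        have := ((hasDerivAt_gPoly x n (u - s)).comp s ((hasDerivAt_id s).const_sub u)).const_mul c
        exact this.neg.congr_deriv (by simp)
      rw [intervalIntegral.integral_eq_sub_of_hasDerivAt hd]
      · simp [gPoly]
      · have := gPoly_cont x n
        exact Continuous.intervalIntegrable (by fun_prop) _ _
    · have := gPoly_cont x n
      exact (Continuous.integrableOn_Icc (by fun_prop)).mono_set Set.Ioc_subset_Icc_self
    · filter_upwards [ae_restrict_mem measurableSet_Ioc] with s hs
      exact mul_nonneg (exp_pos _).le (gPoly_nonneg hx n (by linarith [hs.2]))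

theorem gPoly_zero (t : ℝ) (m : ℕ) :
    gPoly t m 0 = ((m : ℝ) + 1) ^ m / (m + 1).factorial * t ^ m := by
  cases m with
  | zero => simp [gPoly]
  | succ m =>
    have h : ((m + 1).factorial : ℝ) ≠ 0 := by positivity
    simp only [gPoly, Nat.factorial_succ (m + 1)]
    push_cast
    have h2 : (m : ℝ) + 1 + 1 ≠ 0 := by positivity
    have h3 : (0 + ((m : ℝ) + 2) * t) ^ m = ((m : ℝ) + 1 + 1) ^ m * t ^ m := by
      rw [← mul_pow]
      ring
    rw [h3]
    field_simp
    ring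

theorem term_lintegral (m : ℕ) (p : ℝ) (hp : p = 1 ∨ p = 2) :
    ∫⁻ t in Set.Ioi 0, ENNReal.ofReal (exp (-(0 + (m + 1) * t)) * gPoly t m 0) *
      ENNReal.ofReal (t ^ (p - 1)) = ENNReal.ofReal (1 / ((m : ℝ) + 1) ^ 2) := by
  have hp0 : 0 < p := by rcases hp with h | h <;> rw [h] <;> norm_num
  have hm : (0 : ℝ) < m + 1 := by positivity
  set C : ℝ := ((m : ℝ) + 1) ^ m / (m + 1).factorial with hC
  have hC0 : 0 ≤ C := by positivity
  have e : ∀ t ∈ Set.Ioi (0:ℝ), ENNReal.ofReal (exp (-(0 + (m + 1) * t)) * gPoly t m 0) *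
      ENNReal.ofReal (t ^ (p - 1)) = ENNReal.ofReal C *
        ENNReal.ofReal (t ^ ((m + p) - 1) * exp (-((m + 1) * t))) := by
    intro t ht
    have ht : 0 < t := ht
    rw [gPoly_zero, ← ENNReal.ofReal_mul (by positivity), ← ENNReal.ofReal_mul hC0, add_sub_assoc,
      rpow_add ht, rpow_natCast, zero_add]
    congr 1
    ring
  rw [setLIntegral_congr_fun measurableSet_Ioi e, lintegral_const_mul _ (by fun_prop),
    lintegral_gamma_kernel (by positivity) hm, ← ENNReal.ofReal_mul hC0]
  congr 1
  have hf : (m.factorial : ℝ) ≠ 0 := by positivity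
  rcases hp with rfl | rfl
  · rw [Gamma_nat_eq_factorial, rpow_add (by positivity), rpow_natCast, rpow_one, hC, one_div, inv_pow,
      Nat.factorial_succ]
    push_cast
    field_simp
  · have : (m : ℝ) + 2 = ((m + 1 : ℕ) : ℝ) + 1 := by push_cast; ring
    rw [this, Gamma_nat_eq_factorial, rpow_add (by positivity), rpow_natCast, rpow_one, hC, one_div, inv_pow,
      Nat.factorial_succ]
    push_cast
    field_simp
    ring

theorem tsum_val : ∑' m : ℕ, ENNReal.ofReal (1 / ((m : ℝ) + 1) ^ 2) =
    ENNReal.ofReal (π ^ 2 / 6) := by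
  have h := (hasSum_nat_add_iff' 1).2 hasSum_zeta_two
  simp only [Finset.range_one, Finset.sum_singleton, Nat.cast_zero, Nat.cast_add, Nat.cast_one] at h
  norm_num at h
  rw [← ENNReal.ofReal_tsum_of_nonneg (fun m => by positivity)]
  · congr 1
    simpa using h.tsum_eq
  · simpa using h.summable

section
variable {Ω : Type*} [MeasureSpace Ω] [IsProbabilityMeasure (ℙ : Measure Ω)]

theorem ae_pos_of_law {Y : Ω → ℝ} (hY : Measurable Y)
    (hd : Measure.map Y ℙ = expMeasure 1) : ∀ᵐ ω ∂ℙ, 0 < Y ω := by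
  have h := expMeasure_one_Ioi le_rfl
  rw [← hd, Measure.map_apply hY measurableSet_Ioi] at h
  have := (mem_ae_iff_prob_eq_one (μ := (ℙ : Measure Ω)) (hY measurableSet_Ioi)).2 (by simpa using h)
  exact this

theorem integrable_of_law {Y : Ω → ℝ} (hY : Measurable Y)
    (hd : Measure.map Y ℙ = expMeasure 1) : Integrable Y ℙ := by
  refine ⟨hY.aestronglyMeasurable, ?_⟩
  rw [hasFiniteIntegral_iff_ofReal ((ae_pos_of_law hY hd).mono fun _ h => h.le),
    ← lintegral_map (f := fun s => ENNReal.ofReal s) (by fun_prop) hY, hd,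
    lintegral_expMeasure_one _ (by fun_prop)]
  have h := lintegral_gamma_kernel (a := 2) (r := 1) (by norm_num) (by norm_num)
  have e : ∀ t ∈ Set.Ioi (0:ℝ), ENNReal.ofReal (exp (-t)) * ENNReal.ofReal t =
      ENNReal.ofReal (t ^ ((2:ℝ) - 1) * exp (-(1 * t))) := by
    intro t ht
    rw [← ENNReal.ofReal_mul (exp_pos _).le]
    norm_num
    rw [mul_comm]
  rw [setLIntegral_congr_fun measurableSet_Ioi e, h]
  exact ENNReal.ofReal_lt_top

theorem ae_bdd (X : ℕ → Ω → ℝ) (hmeas : ∀ i, Measurable (X i))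
    (hindep : iIndepFun X ℙ) (hdist : ∀ i, Measure.map (X i) ℙ = expMeasure 1) :
    ∀ᵐ ω ∂(ℙ : Measure Ω), BddAbove (Set.range fun i : ℕ =>
      (∑ j ∈ Finset.range (i + 1), X j ω) / ((i : ℝ) + 1)) := by
  have h := strong_law_ae_real X (integrable_of_law (hmeas 0) (hdist 0))
    (fun i j hij => hindep.indepFun hij)
    (fun i => ⟨(hmeas i).aemeasurable, (hmeas 0).aemeasurable, by rw [hdist, hdist]⟩)
  filter_upwards [h] with ω hω
  have := (hω.comp (Filter.tendsto_add_atTop_nat 1)).bddAbove_range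
  simpa [Function.comp_def] using this

theorem lintegral_pow (X : ℕ → Ω → ℝ) (hmeas : ∀ i, Measurable (X i))
    (hindep : iIndepFun X ℙ)
    (hdist : ∀ i, Measure.map (X i) ℙ = expMeasure 1)
    (Z : Ω → ℝ)
    (hZ : ∀ ω, Z ω = ⨆ i : ℕ, (∑ j ∈ Finset.range (i + 1), X j ω) / (i + 1))
    (hZm : Measurable Z) (hZn : 0 ≤ᵐ[ℙ] Z) (p : ℝ) (hp : p = 1 ∨ p = 2) :
    ∫⁻ ω, ENNReal.ofReal (Z ω ^ p) ∂ℙ = ENNReal.ofReal p * ENNReal.ofReal (π ^ 2 / 6) := by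
  have hp0 : 0 < p := by rcases hp with h | h <;> rw [h] <;> norm_num
  have key : ∀ t ∈ Set.Ioi (0:ℝ), (ℙ : Measure Ω) {ω | t < Z ω} * ENNReal.ofReal (t ^ (p - 1)) =
      ∑' m : ℕ, ENNReal.ofReal (exp (-(0 + (m + 1) * t)) * gPoly t m 0) *
        ENNReal.ofReal (t ^ (p - 1)) := by
    intro t ht
    have ht : 0 < t := ht
    rw [ENNReal.tsum_mul_right]
    congr 1
    have hU : (ℙ : Measure Ω) {ω | t < Z ω} =
        ℙ (⋃ m : ℕ, {ω | crossEv t m 0 (fun i => X i ω)}) := by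
      apply measure_congr
      filter_upwards [ae_bdd X hmeas hindep hdist] with ω hω
      apply propext
      change t < Z ω ↔ ω ∈ ⋃ m : ℕ, {ω | crossEv t m 0 (fun i => X i ω)}
      rw [hZ, lt_ciSup_iff hω, Set.mem_iUnion]
      have hdiv : ∀ i : ℕ, t < (∑ j ∈ Finset.range (i + 1), X j ω) / ((i : ℝ) + 1) ↔
          0 + ((i : ℝ) + 1) * t < ∑ j ∈ Finset.range (i + 1), X j ω := by
        intro i
        rw [lt_div_iff₀ (by positivity), zero_add, mul_comm]
      constructor
      · intro hex
        classical
        refine ⟨Nat.find hex, ?_⟩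
        change crossEv _ _ _ _
        rw [crossEv_iff]
        refine ⟨fun i hi => ?_, (hdiv _).1 (Nat.find_spec hex)⟩
        have := Nat.find_min hex hi
        rw [hdiv] at this
        exact not_lt.1 this
      · rintro ⟨m, hm⟩
        change crossEv _ _ _ _ at hm
        rw [crossEv_iff] at hm
        exact ⟨m, (hdiv m).2 hm.2⟩
    rw [hU, measure_iUnion]
    · congr 1
      ext m
      exact prob_crossEv ht.le m X hmeas hindep hdist 0 (by linarith)
    · have hlt : ∀ i j : ℕ, i < j → Disjoint {ω | crossEv t i 0 (fun k => X k ω)}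
          {ω | crossEv t j 0 (fun k => X k ω)} := by
        intro i j hij
        rw [Set.disjoint_left]
        intro ω h1 h2
        change crossEv _ _ _ _ at h1 h2
        rw [crossEv_iff] at h1 h2
        exact absurd h1.2 (not_lt.2 (h2.1 i hij))
      intro i j hij
      rcases lt_or_gt_of_ne hij with h | h
      · exact hlt i j h
      · exact (hlt j i h).symm
    · intro m
      have hg : Measurable fun ω => ((0:ℝ), fun i => X i ω) := by fun_prop
      exact hg (measurable_crossEv t m)
  rw [lintegral_rpow_eq_lintegral_meas_lt_mul _ hZn hZm.aemeasurable hp0,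
    setLIntegral_congr_fun measurableSet_Ioi key, lintegral_tsum]
  · simp_rw [term_lintegral _ p hp]
    rw [tsum_val]
  · intro m
    simp_rw [gPoly_zero]
    fun_prop

end

/-- If `(X i)` are i.i.d. exponential random variables with mean 1 and
`Z_∞ = sup{X̄_i : i ≥ 1}`, then `E[Z_∞] = π²/6` and `Var(Z_∞) = (π²/6)(2 - π²/6)`. -/
theorem supSampleMean_mean_variance
    {Ω : Type*} [MeasureSpace Ω] [IsProbabilityMeasure (ℙ : Measure Ω)]
    (X : ℕ → Ω → ℝ) (hmeas : ∀ i, Measurable (X i))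
    (hindep : iIndepFun X ℙ)
    (hdist : ∀ i, Measure.map (X i) ℙ = expMeasure 1)
    (Z : Ω → ℝ)
    (hZ : ∀ ω, Z ω = ⨆ i : ℕ, (∑ j ∈ Finset.range (i + 1), X j ω) / (i + 1)) :
    (∫ ω, Z ω ∂ℙ = π ^ 2 / 6) ∧ variance Z ℙ = π ^ 2 / 6 * (2 - π ^ 2 / 6) := by
  have hZm : Measurable Z := by
    rw [funext hZ]
    exact Measurable.iSup fun i => by fun_prop
  have hZn : 0 ≤ᵐ[ℙ] Z := by
    filter_upwards [ae_bdd X hmeas hindep hdist, ae_pos_of_law (hmeas 0) (hdist 0)] with ω h1 h2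
    rw [hZ]
    have := le_ciSup h1 0
    simp only [zero_add, Finset.range_one, Finset.sum_singleton, Nat.cast_zero, div_one] at this
    exact h2.le.trans this
  have h1 := lintegral_pow X hmeas hindep hdist Z hZ hZm hZn 1 (Or.inl rfl)
  have h2 := lintegral_pow X hmeas hindep hdist Z hZ hZm hZn 2 (Or.inr rfl)
  simp only [rpow_one, ENNReal.ofReal_one, one_mul] at h1
  simp only [rpow_two] at h2
  have i1 : ∫ ω, Z ω ∂ℙ = π ^ 2 / 6 := by
    rw [integral_eq_lintegral_of_nonneg_ae hZn hZm.aestronglyMeasurable, h1,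
      ENNReal.toReal_ofReal (by positivity)]
  have hsq : 0 ≤ᵐ[ℙ] fun ω => Z ω ^ 2 := Filter.Eventually.of_forall fun ω => sq_nonneg _
  have i2 : ∫ ω, Z ω ^ 2 ∂ℙ = 2 * (π ^ 2 / 6) := by
    rw [integral_eq_lintegral_of_nonneg_ae hsq (hZm.pow_const 2).aestronglyMeasurable, h2,
      ENNReal.toReal_mul, ENNReal.toReal_ofReal (by positivity), ENNReal.toReal_ofReal (by positivity)]
  have hL : MemLp Z 2 ℙ := by
    rw [memLp_two_iff_integrable_sq hZm.aestronglyMeasurable]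
    refine ⟨(hZm.pow_const 2).aestronglyMeasurable, ?_⟩
    rw [hasFiniteIntegral_iff_ofReal hsq, h2]
    exact ENNReal.mul_lt_top ENNReal.ofReal_lt_top ENNReal.ofReal_lt_top
  refine ⟨i1, ?_⟩
  rw [variance_eq_sub hL, i1]
  have : ∫ ω, (Z ^ 2) ω ∂ℙ = 2 * (π ^ 2 / 6) := i2
  rw [this]
  ring
end

section
/- Let (X_i)_{i≥1} be i.i.d. exponential random variables with mean 1, X̄_i := (X_1 + ... + X_i)/i, M_2 := sup{X̄_i : i ≥ 2}, and F_∞(x) := P(sup{X̄_i : i ≥ 1} ≤ x). Then for every x ≥ 0, P(M_2 ≤ x) = F_∞(x) + e^{−2x} · F_∞(x) / (1 − F_∞(x)) whenever F_∞(x) < 1. -/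
open MeasureTheory ProbabilityTheory Real

namespace SupMean

/-- The law of an i.i.d. sequence of standard exponentials. -/
noncomputable def seqLaw : Measure (ℕ → ℝ) := Measure.infinitePi (fun _ => expMeasure 1)

instance : IsProbabilityMeasure (expMeasure 1) := isProbabilityMeasure_expMeasure one_pos

instance : IsProbabilityMeasure seqLaw := by unfold seqLaw; infer_instance

/-- Prepend a number to a sequence. -/
def pre (y : ℝ) (z : ℕ → ℝ) : ℕ → ℝ
  | 0 => y
  | n + 1 => z n

lemma measurable_pre : Measurable (fun p : ℝ × (ℕ → ℝ) => pre p.1 p.2) := by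
  rw [measurable_pi_iff]
  intro n
  cases n with
  | zero => exact measurable_fst
  | succ n => exact (measurable_pi_apply n).comp measurable_snd

lemma map_pre : ((expMeasure 1).prod seqLaw).map (fun p => pre p.1 p.2) = seqLaw := by
  classical
  apply Measure.eq_infinitePi
  intro s t ht
  obtain ⟨N, hN⟩ : ∃ N, s ⊆ Finset.range (N + 1) := by
    obtain ⟨N, hN⟩ := s.exists_nat_subset_range
    exact ⟨N, hN.trans (Finset.range_mono (Nat.le_succ N))⟩
  set t' : ℕ → Set ℝ := fun i => if i ∈ s then t i else Set.univ with ht'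
  have hm : ∀ i, MeasurableSet (t' i) := by
    intro i
    simp only [ht']
    split_ifs
    · exact ht i
    · exact MeasurableSet.univ
  have h1 : Set.pi (s : Set ℕ) t = Set.pi (Finset.range (N + 1) : Set ℕ) t' := by
    ext z
    simp only [Set.mem_pi, ht']
    constructor
    · intro h i _
      by_cases hi : i ∈ s
      · simpa [hi] using h i hi
      · simp [hi]
    · intro h i hi
      have hi' : i ∈ s := hi
      simpa [hi'] using h i (hN hi')
  have h2 : ∏ i ∈ s, expMeasure 1 (t i) = ∏ i ∈ Finset.range (N + 1), expMeasure 1 (t' i) := by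
    rw [← Finset.prod_subset hN]
    · refine Finset.prod_congr rfl fun i hi => ?_
      simp [ht', hi]
    · intro i _ hi
      simp [ht', hi]
  rw [h1, h2, Measure.map_apply measurable_pre
    (MeasurableSet.pi (Finset.countable_toSet _) fun i _ => hm i)]
  have h3 : (fun p : ℝ × (ℕ → ℝ) => pre p.1 p.2) ⁻¹' Set.pi (Finset.range (N + 1) : Set ℕ) t'
      = t' 0 ×ˢ Set.pi (Finset.range N : Set ℕ) (fun i => t' (i + 1)) := by
    ext p
    simp only [Set.mem_preimage, Set.mem_pi, Set.mem_prod, Finset.coe_range, Set.mem_Iio]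
    constructor
    · intro h
      exact ⟨h 0 (by omega), fun i hi => h (i + 1) (by omega)⟩
    · rintro ⟨h0, h⟩ i hi
      cases i with
      | zero => exact h0
      | succ i => exact h i (by omega)
  rw [h3, Measure.prod_prod, seqLaw, Measure.infinitePi_pi _ (fun i _ => hm (i + 1)),
    Finset.prod_range_succ', mul_comm]

/-- First step decomposition. -/
lemma seqLaw_apply {A : Set (ℕ → ℝ)} (hA : MeasurableSet A) :
    seqLaw A = ∫⁻ y, seqLaw {z | pre y z ∈ A} ∂(expMeasure 1) := by
  conv_lhs => rw [← map_pre, Measure.map_apply measurable_pre hA,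
    Measure.prod_apply (measurable_pre hA)]
  rfl

lemma measurable_slice {A : Set (ℕ → ℝ)} (hA : MeasurableSet A) :
    Measurable fun y => seqLaw {z | pre y z ∈ A} :=
  measurable_measure_prodMk_left (measurable_pre hA)

lemma lintegral_exp {f : ℝ → ENNReal} (hf : Measurable f) :
    ∫⁻ y, f y ∂(expMeasure 1) = ∫⁻ y, exponentialPDF 1 y * f y := by
  have hm : Measurable (exponentialPDF 1) := (measurable_exponentialPDFReal 1).ennreal_ofReal
  exact lintegral_withDensity_eq_lintegral_mul _ hm hf

/-- Memorylessness. -/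
lemma memoryless {f : ℝ → ENNReal} (hf : Measurable f) {w : ℝ} (hw : 0 ≤ w) :
    ∫⁻ y in Set.Ioi w, f (y - w) ∂(expMeasure 1)
      = ENNReal.ofReal (Real.exp (-w)) * ∫⁻ y, f y ∂(expMeasure 1) := by
  have hm : Measurable (exponentialPDF 1) := (measurable_exponentialPDFReal 1).ennreal_ofReal
  have hf' : Measurable fun y => f (y - w) := hf.comp (measurable_id.sub_const w)
  rw [← lintegral_indicator measurableSet_Ioi, lintegral_exp (hf'.indicator measurableSet_Ioi),
    lintegral_exp hf, ← lintegral_const_mul _ (f := fun y => exponentialPDF 1 y * f y) (hm.mul hf),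
    ← lintegral_add_right_eq_self _ w]
  apply lintegral_congr_ae
  have h0 : ∀ᵐ t : ℝ, t ≠ 0 := by
    simp [ae_iff]
  filter_upwards [h0] with t ht
  rcases lt_or_gt_of_ne ht with h | h
  · rw [Set.indicator_of_notMem (by simp [h.le]), exponentialPDF_of_neg h]
    simp
  · rw [Set.indicator_of_mem (by simp [h]), exponentialPDF_of_nonneg h.le,
      exponentialPDF_of_nonneg (by linarith), add_sub_cancel_right, ← mul_assoc,
      ← ENNReal.ofReal_mul (Real.exp_pos _).le]
    congr 2
    rw [one_mul, one_mul, one_mul, one_mul, ← Real.exp_add]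
    congr 1
    ring

lemma exp_Ioi {w : ℝ} (hw : 0 ≤ w) :
    expMeasure 1 (Set.Ioi w) = ENNReal.ofReal (Real.exp (-w)) := by
  have := memoryless (f := fun _ => 1) measurable_const hw
  simpa using this

lemma exp_Iic_neg {w : ℝ} (hw : w < 0) : expMeasure 1 (Set.Iic w) = 0 := by
  have h := cdf_expMeasure_eq one_pos w
  rw [if_neg (not_le.mpr hw), cdf_eq_real, measureReal_def] at h
  rcases (ENNReal.toReal_eq_zero_iff _).1 h with h | h
  · exact h
  · exact absurd h (measure_ne_top _ _)

/-- partial sums -/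
def S (n : ℕ) (z : ℕ → ℝ) : ℝ := ∑ j ∈ Finset.range n, z j

lemma S_pre (n : ℕ) (y : ℝ) (z : ℕ → ℝ) : S (n + 1) (pre y z) = y + S n z := by
  unfold S
  rw [Finset.sum_range_succ', add_comm]
  rfl

@[fun_prop]
lemma measurable_S (n : ℕ) : Measurable (S n) := by
  unfold S
  fun_prop

/-- The walk stays below the line. -/
def Hset (x v : ℝ) : Set (ℕ → ℝ) := {z | ∀ n : ℕ, S (n + 1) z ≤ n * x + v}

/-- The walk crosses the line before time `N`. -/
def Eset (x : ℝ) (N : ℕ) (w : ℝ) : Set (ℕ → ℝ) := {z | ∃ n < N, n * x + w < S (n + 1) z}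

lemma measurableSet_Hset (x v : ℝ) : MeasurableSet (Hset x v) := by
  have : Hset x v = ⋂ n : ℕ, {z | S (n + 1) z ≤ n * x + v} := by
    ext z; simp [Hset]
  rw [this]
  exact MeasurableSet.iInter fun n => measurableSet_le (measurable_S _) measurable_const

lemma measurableSet_Eset (x : ℝ) (N : ℕ) (w : ℝ) : MeasurableSet (Eset x N w) := by
  have : Eset x N w = ⋃ n : ℕ, ⋃ _ : n < N, {z | n * x + w < S (n + 1) z} := by
    ext z; simp [Eset]
  rw [this]
  exact MeasurableSet.iUnion fun n => MeasurableSet.iUnion fun _ =>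
    measurableSet_lt measurable_const (measurable_S _)

lemma pre_mem_Hset (x v y : ℝ) (z : ℕ → ℝ) :
    pre y z ∈ Hset x v ↔ y ≤ v ∧ z ∈ Hset x (v - y + x) := by
  simp only [Hset, Set.mem_ofPred_eq, S_pre]
  constructor
  · intro h
    refine ⟨by simpa [S] using h 0, fun n => ?_⟩
    have := h (n + 1)
    push_cast at this
    linarith
  · rintro ⟨h0, h⟩ n
    cases n with
    | zero => simpa [S] using h0
    | succ n =>
      have := h n
      push_cast
      linarith

lemma pre_mem_Hset_shift (x v w y : ℝ) (z : ℕ → ℝ) :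
    pre y z ∈ Hset x (w + v) ↔ pre (y - w) z ∈ Hset x v := by
  rw [pre_mem_Hset, pre_mem_Hset, show w + v - y + x = v - (y - w) + x by ring]
  constructor <;> rintro ⟨h, h'⟩ <;> exact ⟨by linarith, h'⟩

lemma pre_mem_Eset (x w y : ℝ) (N : ℕ) (z : ℕ → ℝ) :
    pre y z ∈ Eset x (N + 1) w ↔ w < y ∨ z ∈ Eset x N (w - y + x) := by
  simp only [Eset, Set.mem_ofPred_eq, S_pre]
  constructor
  · rintro ⟨n, hn, h⟩
    cases n with
    | zero => left; simpa [S] using h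
    | succ n =>
      right
      refine ⟨n, by omega, ?_⟩
      push_cast at h
      linarith
  · rintro (h | ⟨n, hn, h⟩)
    · exact ⟨0, by omega, by simpa [S] using h⟩
    · refine ⟨n + 1, by omega, ?_⟩
      push_cast
      linarith

lemma seqLaw_Eset_succ (x : ℝ) (N : ℕ) (w : ℝ) :
    seqLaw (Eset x (N + 1) w) =
      ∫⁻ y in Set.Iic w, seqLaw (Eset x N (w - y + x)) ∂(expMeasure 1)
        + expMeasure 1 (Set.Ioi w) := by
  rw [seqLaw_apply (measurableSet_Eset _ _ _), ← lintegral_add_compl _ (measurableSet_Iic (a := w)),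
    Set.compl_Iic]
  congr 1
  · refine setLIntegral_congr_fun measurableSet_Iic fun y hy => ?_
    have hy' : ¬ w < y := not_lt.mpr hy
    simp only [pre_mem_Eset, hy', false_or]
    rfl
  · rw [← setLIntegral_one]
    refine setLIntegral_congr_fun measurableSet_Ioi fun y hy => ?_
    have hy' : w < y := hy
    simp [pre_mem_Eset, hy']

lemma crossing (x : ℝ) (hx : 0 ≤ x) {v : ℝ} (hv : 0 ≤ v) (N : ℕ) :
    ∀ w : ℝ, 0 ≤ w → seqLaw (Eset x N w ∩ (Hset x (w + v))ᶜ)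
      = seqLaw (Eset x N w) * seqLaw (Hset x v)ᶜ := by
  induction N with
  | zero => intro w _; simp [Eset]
  | succ N ih =>
    intro w hw
    rw [seqLaw_Eset_succ, seqLaw_apply
      ((measurableSet_Eset _ _ _).inter (measurableSet_Hset _ _).compl),
      ← lintegral_add_compl _ (measurableSet_Iic (a := w)), Set.compl_Iic, add_mul]
    congr 1
    · rw [← lintegral_mul_const' _ _ (measure_ne_top _ _)]
      refine setLIntegral_congr_fun measurableSet_Iic fun y hy => ?_
      have hy1 : y ≤ w := hy
      have hy' : ¬ w < y := not_lt.mpr hy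
      have hy2 : y ≤ w + v := by linarith
      rw [← ih (w - y + x) (by linarith)]
      congr 1
      ext z
      simp only [Set.mem_ofPred_eq, Set.mem_inter_iff, Set.mem_compl_iff, pre_mem_Eset,
        pre_mem_Hset, hy', hy2, false_or, true_and]
      rw [show w + v - y + x = w - y + x + v by ring]
    · rw [exp_Ioi hw, seqLaw_apply (measurableSet_Hset x v).compl,
        ← memoryless (measurable_slice (measurableSet_Hset x v).compl) hw]
      refine setLIntegral_congr_fun measurableSet_Ioi fun y hy => ?_
      have hy' : w < y := hy
      congr 1
      ext z
      simp only [Set.mem_ofPred_eq, Set.mem_inter_iff, Set.mem_compl_iff, pre_mem_Eset, hy',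
        true_or, true_and, pre_mem_Hset_shift]

lemma Eset_mono (x w : ℝ) : Monotone fun N => Eset x N w := by
  rintro N M h z ⟨n, hn, hz⟩
  exact ⟨n, hn.trans_le h, hz⟩

lemma iUnion_Eset (x w : ℝ) : ⋃ N, Eset x N w = (Hset x w)ᶜ := by
  ext z
  simp only [Set.mem_iUnion, Eset, Hset, Set.mem_ofPred_eq, Set.mem_compl_iff, not_forall, not_le]
  constructor
  · rintro ⟨_, n, _, h⟩
    exact ⟨n, h⟩
  · rintro ⟨n, h⟩
    exact ⟨n + 1, n, by omega, h⟩

lemma compl_mul (x : ℝ) (hx : 0 ≤ x) {v w : ℝ} (hv : 0 ≤ v) (hw : 0 ≤ w) :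
    seqLaw (Hset x (w + v))ᶜ = seqLaw (Hset x w)ᶜ * seqLaw (Hset x v)ᶜ := by
  have h1 : Filter.Tendsto (fun N => seqLaw (Eset x N w)) Filter.atTop
      (nhds (seqLaw (Hset x w)ᶜ)) := by
    rw [← iUnion_Eset]
    exact tendsto_measure_iUnion_atTop (Eset_mono x w)
  have h2 : Filter.Tendsto (fun N => seqLaw (Eset x N w ∩ (Hset x (w + v))ᶜ)) Filter.atTop
      (nhds (seqLaw (Hset x (w + v))ᶜ)) := by
    have : (Hset x (w + v))ᶜ = ⋃ N, Eset x N w ∩ (Hset x (w + v))ᶜ := by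
      rw [← Set.iUnion_inter, iUnion_Eset, eq_comm, Set.inter_eq_right, Set.compl_subset_compl]
      intro z hz n
      have := hz n
      linarith
    conv => enter [3, 1]; rw [this]
    exact tendsto_measure_iUnion_atTop fun N M h => Set.inter_subset_inter_left _ (Eset_mono x w h)
  simp_rw [crossing x hx hv _ w hw] at h2
  exact tendsto_nhds_unique h2
    (ENNReal.Tendsto.mul_const h1 (Or.inr (measure_ne_top _ _)))

lemma Hset_neg (x : ℝ) {v : ℝ} (hv : v < 0) : seqLaw (Hset x v) = 0 := by
  rw [seqLaw_apply (measurableSet_Hset _ _), lintegral_eq_zero_iff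
    (measurable_slice (measurableSet_Hset _ _))]
  have : ∀ᵐ y ∂(expMeasure 1), ¬ y ≤ v := by
    rw [ae_iff]
    simp only [not_not]
    exact exp_Iic_neg hv
  filter_upwards [this] with y hy
  simp [pre_mem_Hset, hy]

/-- The event that all means from the second on are at most `x`. -/
def Mset (x : ℝ) : Set (ℕ → ℝ) := {z | ∀ n : ℕ, S (n + 2) z ≤ (n + 2) * x}

lemma measurableSet_Mset (x : ℝ) : MeasurableSet (Mset x) := by
  have : Mset x = ⋂ n : ℕ, {z | S (n + 2) z ≤ (n + 2) * x} := by
    ext z; simp [Mset]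
  rw [this]
  exact MeasurableSet.iInter fun n => measurableSet_le (measurable_S _) measurable_const

lemma pre_mem_Mset (x y : ℝ) (z : ℕ → ℝ) : pre y z ∈ Mset x ↔ z ∈ Hset x (2 * x - y) := by
  simp only [Mset, Hset, Set.mem_ofPred_eq, S_pre]
  refine forall_congr' fun n => ?_
  constructor <;> intro h <;> linarith

lemma Hset_add (x : ℝ) (hx : 0 ≤ x) {v : ℝ} (hv : 0 ≤ v) :
    seqLaw (Hset x (v + x)) = seqLaw (Hset x x) + seqLaw (Hset x x)ᶜ * seqLaw (Hset x v) := by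
  have h := compl_mul x hx hv hx
  rw [add_comm x v] at h
  have e1 := prob_add_prob_compl (μ := seqLaw) (measurableSet_Hset x (v + x))
  have e2 := prob_add_prob_compl (μ := seqLaw) (measurableSet_Hset x x)
  have e3 := prob_add_prob_compl (μ := seqLaw) (measurableSet_Hset x v)
  rw [h] at e1
  have hfin : seqLaw (Hset x x)ᶜ * seqLaw (Hset x v)ᶜ ≠ ⊤ :=
    ENNReal.mul_ne_top (measure_ne_top _ _) (measure_ne_top _ _)
  apply (ENNReal.add_left_inj hfin).1
  rw [e1, add_assoc, ← mul_add, e3, mul_one, e2]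

lemma two_eq (x : ℝ) (hx : 0 ≤ x) :
    seqLaw (Hset x (2 * x)) = seqLaw (Hset x x) * expMeasure 1 (Set.Iic (2 * x))
      + seqLaw (Hset x x)ᶜ * seqLaw (Mset x) := by
  have hm : Measurable fun y => seqLaw (Hset x (2 * x - y)) := by
    have := measurable_slice (measurableSet_Mset x)
    simpa only [pre_mem_Mset, Set.ofPred_mem_eq] using this
  rw [seqLaw_apply (measurableSet_Hset _ _), seqLaw_apply (measurableSet_Mset _),
    ← lintegral_const_mul' _ _ (measure_ne_top _ _), ← setLIntegral_const,
    ← lintegral_indicator measurableSet_Iic,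
    ← lintegral_add_left (measurable_const.indicator measurableSet_Iic)]
  refine lintegral_congr fun y => ?_
  simp only [pre_mem_Mset, pre_mem_Hset, Set.ofPred_mem_eq]
  by_cases hy : y ≤ 2 * x
  · rw [Set.indicator_of_mem (by exact hy), ← Hset_add x hx (by linarith)]
    simp [hy]
  · rw [Set.indicator_of_notMem (by exact hy), Hset_neg x (by linarith)]
    simp [hy]

lemma final (x : ℝ) (hx : 0 ≤ x) (h : (seqLaw (Hset x x)).toReal < 1) :
    (seqLaw (Mset x)).toReal = (seqLaw (Hset x x)).toReal +
      Real.exp (-(2 * x)) * (seqLaw (Hset x x)).toReal / (1 - (seqLaw (Hset x x)).toReal) := by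
  have h1 := two_eq x hx
  have h2 := Hset_add x hx hx
  rw [← two_mul, h1] at h2
  have h3 := congrArg ENNReal.toReal h2
  have e2 : (seqLaw (Hset x x)ᶜ).toReal = 1 - (seqLaw (Hset x x)).toReal :=
    probReal_compl_eq_one_sub (measurableSet_Hset x x)
  have e3 : (expMeasure 1 (Set.Iic (2 * x))).toReal = 1 - Real.exp (-(2 * x)) := by
    rw [← measureReal_def, ← cdf_eq_real, cdf_expMeasure_eq one_pos, if_pos (by linarith), one_mul]
  rw [ENNReal.toReal_add (by finiteness) (by finiteness),
    ENNReal.toReal_add (by finiteness) (by finiteness), ENNReal.toReal_mul, ENNReal.toReal_mul,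
    ENNReal.toReal_mul, e2, e3] at h3
  have hne : 1 - (seqLaw (Hset x x)).toReal ≠ 0 := by linarith
  field_simp
  linarith

end SupMean


/-- If `(X i)` are i.i.d. exponential random variables with mean 1,
`M_2 = sup{X̄_i : i ≥ 2}` and `F_∞` is the CDF of `sup{X̄_i : i ≥ 1}`, then for every
`x ≥ 0` with `F_∞(x) < 1`, `P(M_2 ≤ x) = F_∞(x) + e^{-2x}·F_∞(x)/(1 - F_∞(x))`. -/
theorem cdf_supSampleMean_from_two
    {Ω : Type*} [MeasureSpace Ω] [IsProbabilityMeasure (ℙ : Measure Ω)]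
    (X : ℕ → Ω → ℝ) (hmeas : ∀ i, Measurable (X i))
    (hindep : iIndepFun X ℙ)
    (hdist : ∀ i, Measure.map (X i) ℙ = expMeasure 1)
    (F : ℝ → ℝ)
    (hF : ∀ x : ℝ, F x =
      (ℙ {ω | ∀ i : ℕ, 1 ≤ i → (∑ j ∈ Finset.range i, X j ω) / i ≤ x}).toReal)
    (x : ℝ) (hx : 0 ≤ x) (hFx : F x < 1) :
    (ℙ {ω | ∀ i : ℕ, 2 ≤ i → (∑ j ∈ Finset.range i, X j ω) / i ≤ x}).toReal
      = F x + Real.exp (-(2 * x)) * F x / (1 - F x) := by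
  have hlaw : (ℙ : Measure Ω).map (fun ω i => X i ω) = SupMean.seqLaw := by
    rw [hindep.map_fun_eq_infinitePi_map hmeas]
    simp only [hdist]
    rfl
  have hX : Measurable (fun ω i => X i ω) := measurable_pi_iff.2 hmeas
  have h1 : ℙ {ω | ∀ i : ℕ, 1 ≤ i → (∑ j ∈ Finset.range i, X j ω) / i ≤ x}
      = SupMean.seqLaw (SupMean.Hset x x) := by
    rw [← hlaw, Measure.map_apply hX (SupMean.measurableSet_Hset x x)]
    congr 1
    ext ω
    simp only [Set.mem_ofPred_eq, Set.mem_preimage, SupMean.Hset, SupMean.S]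
    constructor
    · intro h n
      have := h (n + 1) (by omega)
      rw [div_le_iff₀ (by positivity)] at this
      push_cast at this
      linarith
    · intro h i hi
      obtain ⟨n, rfl⟩ := Nat.exists_eq_add_of_le' hi
      rw [div_le_iff₀ (by positivity)]
      have := h n
      push_cast
      linarith
  have h2 : ℙ {ω | ∀ i : ℕ, 2 ≤ i → (∑ j ∈ Finset.range i, X j ω) / i ≤ x}
      = SupMean.seqLaw (SupMean.Mset x) := by
    rw [← hlaw, Measure.map_apply hX (SupMean.measurableSet_Mset x)]
    congr 1
    ext ω
    simp only [Set.mem_ofPred_eq, Set.mem_preimage, SupMean.Mset, SupMean.S]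
    constructor
    · intro h n
      have := h (n + 2) (by omega)
      rw [div_le_iff₀ (by positivity)] at this
      push_cast at this
      linarith
    · intro h i hi
      obtain ⟨n, rfl⟩ := Nat.exists_eq_add_of_le' hi
      rw [div_le_iff₀ (by positivity)]
      have := h n
      push_cast
      linarith
  have hFx' := hF x
  rw [h1] at hFx'
  rw [hFx'] at hFx
  rw [h2, hFx']
  exact SupMean.final x hx hFx
end

section
/- Let (X_i)_{i≥1} be i.i.d. exponential random variables with mean 1 and, for λ > −1 and n ∈ ℕ⁺, let Z_{n;λ} := max{ (X_1 + ... + X_k)/(k + λ) : k = 1, ..., n }. Then for every x ≥ 0, P(Z_{n;λ} ≤ x) = 1 − (1 + λ) e^{−λx} Σ_{k=1}^{n} (k (k + λ)^{k−2} / k!) x^{k−1} e^{−kx}. -/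
open MeasureTheory ProbabilityTheory Real

/-- Abel-type polynomials. -/
noncomputable def abelP (x : ℝ) : ℕ → ℝ → ℝ
  | 0, _ => 1
  | (k+1), b => b * (b + (k+1) * x) ^ k / (Nat.factorial (k+1))

lemma abelP_succ_zero (x : ℝ) (k : ℕ) : abelP x (k+1) 0 = 0 := by simp [abelP]

lemma abelP_hasDerivAt (x : ℝ) (k : ℕ) (b : ℝ) :
    HasDerivAt (abelP x (k+1)) (abelP x k (b + x)) b := by
  cases k with
  | zero =>
    have : abelP x (0+1) = fun b => b := by
      funext b; simp [abelP]
    rw [this]; exact hasDerivAt_id' b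
  | succ k =>
    have h1 : HasDerivAt (fun b : ℝ => b + ((k+1 : ℕ)+1) * x) 1 b :=
      (hasDerivAt_id b).add_const _
    have h2 := ((hasDerivAt_id b).mul (h1.pow (k+1))).div_const ((Nat.factorial (k+1+1) : ℕ) : ℝ)
    have h3 : abelP x (k+1+1) = fun b => id b * (b + ((k+1 : ℕ)+1) * x) ^ (k+1) /
        ((Nat.factorial (k+1+1) : ℕ) : ℝ) := by
      funext b; simp [abelP]
    rw [h3]
    refine h2.congr_deriv ?_
    have hf : ((Nat.factorial (k+1) : ℕ) : ℝ) ≠ 0 := by positivity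
    have hk : ((k : ℝ) + 1 + 1) ≠ 0 := by positivity
    rw [Nat.factorial_succ (k+1)]
    simp only [abelP, id]
    push_cast
    field_simp
    simp
    ring

noncomputable def abelF (x : ℝ) (n : ℕ) (b : ℝ) : ℝ :=
  1 - ∑ k ∈ Finset.range n, abelP x k b * Real.exp (-(b + k * x))

lemma abelP_continuous (x : ℝ) (k : ℕ) : Continuous (abelP x k) := by
  cases k with
  | zero => exact continuous_const
  | succ k =>
    exact continuous_iff_continuousAt.2 fun b => (abelP_hasDerivAt x k b).continuousAt

lemma abelF_continuous (x : ℝ) (n : ℕ) : Continuous (abelF x n) := by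
  unfold abelF
  have := abelP_continuous x
  fun_prop

lemma abelF_integral (x : ℝ) (n : ℕ) (b : ℝ) :
    ∫ y in (0:ℝ)..b, Real.exp (-y) * abelF x n (b - y + x) = abelF x (n+1) b := by
  have hd : ∀ y : ℝ, HasDerivAt
      (fun y => -Real.exp (-y) + ∑ k ∈ Finset.range n,
        abelP x (k+1) (b - y) * Real.exp (-(b + (k+1 : ℕ) * x)))
      (Real.exp (-y) * abelF x n (b - y + x)) y := by
    intro y
    have h1 : HasDerivAt (fun y : ℝ => -Real.exp (-y)) (Real.exp (-y)) y := by
      have := ((hasDerivAt_id' y).fun_neg.exp).fun_neg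
      exact this.congr_deriv (by ring)
    have h2 : ∀ k ∈ Finset.range n, HasDerivAt
        (fun y => abelP x (k+1) (b - y) * Real.exp (-(b + (k+1 : ℕ) * x)))
        (-(abelP x k (b - y + x)) * Real.exp (-(b + (k+1 : ℕ) * x))) y := by
      intro k _
      have h := (abelP_hasDerivAt x k (b - y)).comp y ((hasDerivAt_id y).const_sub b)
      simpa using h.mul_const (Real.exp (-(b + (k+1 : ℕ) * x)))
    have h3 := h1.add (HasDerivAt.fun_sum h2)
    refine h3.congr_deriv ?_
    unfold abelF
    rw [mul_sub, mul_one, Finset.mul_sum, sub_eq_add_neg (Real.exp (-y)),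
      ← Finset.sum_neg_distrib]
    congr 1
    refine Finset.sum_congr rfl fun k _ => ?_
    rw [show -(b + (k+1 : ℕ) * x) = -y + -(b - y + x + k * x) by push_cast; ring, Real.exp_add]
    ring
  have hc : Continuous (fun y => Real.exp (-y) * abelF x n (b - y + x)) := by
    have := abelF_continuous x n
    fun_prop
  rw [intervalIntegral.integral_eq_sub_of_hasDerivAt (fun y _ => hd y)
    (hc.intervalIntegrable _ _)]
  simp only [sub_self, abelP_succ_zero, sub_zero, abelF, Finset.sum_range_succ']
  simp [abelP]
  ring

lemma shifted_prob {Ω : Type*} [MeasurableSpace Ω] (μ : Measure Ω) [IsProbabilityMeasure μ]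
    (x : ℝ) (hx : 0 ≤ x) (n : ℕ) :
    ∀ (X : ℕ → Ω → ℝ) (_ : ∀ i, Measurable (X i)) (_ : iIndepFun X μ)
      (_ : ∀ i, Measure.map (X i) μ = expMeasure 1) (b : ℝ) (_ : 0 ≤ b),
      (μ {ω | ∀ k < n, ∑ j ∈ Finset.range (k+1), X j ω ≤ b + k * x}).toReal = abelF x n b := by
  induction n with
  | zero => intro X _ _ _ b _; simp [abelF]
  | succ n ih =>
    intro X hm hi hd b hb
    have ih' := ih (fun i => X (i+1)) (fun i => hm _) (hi.precomp (add_left_injective 1))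
      (fun i => hd _)
    -- tail partial sums
    let W : Ω → (Fin n → ℝ) := fun ω k => ∑ j ∈ Finset.range (k+1), X (j+1) ω
    have hW : Measurable W := by
      refine measurable_pi_lambda _ fun k => ?_
      exact Finset.measurable_fun_sum _ fun j _ => hm _
    have hind : IndepFun (X 0) W μ := by
      have h := hi.indepFun_finset {0} (Finset.Icc 1 n) (by simp) hm
      let φ : (({0} : Finset ℕ) → ℝ) → ℝ := fun v => v ⟨0, by simp⟩
      let ψ : ((Finset.Icc 1 n) → ℝ) → (Fin n → ℝ) := fun v k =>
        ∑ j : Fin (k+1), v ⟨j+1, by have := j.2; have := k.2; simp; omega⟩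
      have hφ : Measurable φ := by fun_prop
      have hψ : Measurable ψ := by fun_prop
      have h' := h.comp hφ hψ
      have e : W = ψ ∘ fun a i => X i a := by
        funext ω k
        simp only [W, ψ, Function.comp]
        rw [Finset.sum_range]
      rw [e]
      exact h'
    have hmap := (indepFun_iff_map_prod_eq_prod_map_map (hm 0).aemeasurable hW.aemeasurable).1 hind
    let A : Set (ℝ × (Fin n → ℝ)) :=
      {p | p.1 ≤ b ∧ ∀ k : Fin n, p.2 k ≤ (b - p.1 + x) + k * x}
    have hA : MeasurableSet A := by
      rw [show A = {a | a.1 ≤ b} ∩ ⋂ k : Fin n, {a | a.2 k ≤ (b - a.1 + x) + k * x} by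
        ext; simp [A]]
      refine MeasurableSet.inter (measurableSet_le measurable_fst measurable_const) ?_
      exact MeasurableSet.iInter fun k => measurableSet_le (by fun_prop) (by fun_prop)
    have hE : {ω | ∀ k < n+1, ∑ j ∈ Finset.range (k+1), X j ω ≤ b + k * x}
        = (fun ω => (X 0 ω, W ω)) ⁻¹' A := by
      ext ω
      simp only [Set.mem_ofPred_eq, Set.mem_preimage, A, W]
      constructor
      · intro h
        refine ⟨by simpa using h 0 (by omega), fun k => ?_⟩
        have := h (k+1) (by omega)
        rw [Finset.sum_range_succ'] at this
        push_cast at this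
        linarith
      · rintro ⟨h0, h⟩ k hk
        cases k with
        | zero => simpa using h0
        | succ k =>
          have := h ⟨k, by omega⟩
          rw [Finset.sum_range_succ']
          push_cast
          simp only at this
          linarith
    have hexp := hd 0
    have hslice : ∀ y, exponentialPDF 1 y * (μ.map W) (Prod.mk y ⁻¹' A) =
        (Set.Icc 0 b).indicator
          (fun y => ENNReal.ofReal (Real.exp (-y) * abelF x n (b - y + x))) y := by
      intro y
      by_cases hy : y ∈ Set.Icc 0 b
      · rw [Set.indicator_of_mem hy, exponentialPDF_of_nonneg hy.1,
          Measure.map_apply hW (measurable_prodMk_left hA), ENNReal.ofReal_mul (Real.exp_pos (-y)).le,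
          ← ih' (b - y + x) (by linarith [hy.2]), ENNReal.ofReal_toReal (by finiteness)]
        congr 2
        · simp
        · ext ω
          simp only [Set.mem_ofPred_eq, Set.mem_preimage, A, W]
          constructor
          · rintro ⟨_, h⟩ k hk
            exact h ⟨k, hk⟩
          · intro h
            exact ⟨hy.2, fun k => h k k.2⟩
      · rw [Set.indicator_of_notMem hy]
        by_cases h0 : y < 0
        · rw [exponentialPDF_of_neg h0, zero_mul]
        · have : Prod.mk y ⁻¹' A = ∅ := by
            ext v
            simp only [Set.mem_preimage, A, Set.mem_ofPred_eq, Set.mem_empty_iff_false, iff_false]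
            rintro ⟨h, _⟩
            exact hy ⟨not_lt.1 h0, h⟩
          simp [this]
    have hmeasPDF : Measurable (exponentialPDF 1) :=
      (measurable_exponentialPDFReal 1).ennreal_ofReal
    have : IsProbabilityMeasure (μ.map W) := Measure.isProbabilityMeasure_map hW.aemeasurable
    have hP : μ {ω | ∀ k < n+1, ∑ j ∈ Finset.range (k+1), X j ω ≤ b + k * x}
        = ∫⁻ y in Set.Icc 0 b, ENNReal.ofReal (Real.exp (-y) * abelF x n (b - y + x)) := by
      rw [hE, ← Measure.map_apply ((hm 0).prodMk hW) hA, hmap, Measure.prod_apply hA, hexp,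
        ← lintegral_indicator measurableSet_Icc]
      change ∫⁻ y, _ ∂(volume.withDensity (exponentialPDF 1)) = _
      rw [lintegral_withDensity_eq_lintegral_mul _ hmeasPDF (measurable_measure_prodMk_left hA)]
      exact lintegral_congr hslice
    have hc : Continuous (fun y => Real.exp (-y) * abelF x n (b - y + x)) := by
      have := abelF_continuous x n
      fun_prop
    rw [hP, ← integral_eq_lintegral_of_nonneg_ae, integral_Icc_eq_integral_Ioc,
      ← intervalIntegral.integral_of_le hb, abelF_integral]
    · filter_upwards [ae_restrict_mem measurableSet_Icc] with y hy
      have := ih' (b - y + x) (by linarith [hy.2])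
      rw [← this]
      exact mul_nonneg (Real.exp_pos _).le ENNReal.toReal_nonneg
    · exact hc.aestronglyMeasurable


/-- If `(X i)` are i.i.d. exponential random variables with mean 1, `lam > -1` and
`Z_{n;lam} = max{(X_1 + ⋯ + X_k)/(k + lam) : k = 1, …, n}`, then for every `x ≥ 0`,
`P(Z_{n;lam} ≤ x) = 1 - (1+lam) e^{-lam·x} ∑_{k=1}^n (k (k+lam)^{k-2}/k!) x^{k-1} e^{-kx}`
(here `(k+lam)^{k-2}` has an integer exponent, which is `-1` for `k = 1`). -/
theorem shiftedMax_cdf_exponential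
    {Ω : Type*} [MeasureSpace Ω] [IsProbabilityMeasure (ℙ : Measure Ω)]
    (X : ℕ → Ω → ℝ) (hmeas : ∀ i, Measurable (X i))
    (hindep : iIndepFun X ℙ)
    (hdist : ∀ i, Measure.map (X i) ℙ = expMeasure 1)
    (lam : ℝ) (hlam : -1 < lam) (n : ℕ) (hn : 1 ≤ n) (x : ℝ) (hx : 0 ≤ x) :
    (ℙ {ω | ∀ k ∈ Finset.Icc 1 n,
        (∑ j ∈ Finset.range k, X j ω) / (k + lam) ≤ x}).toReal
      = 1 - (1 + lam) * Real.exp (-(lam * x)) * ∑ k ∈ Finset.Icc 1 n,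
          (k : ℝ) * ((k : ℝ) + lam) ^ ((k : ℤ) - 2) / (Nat.factorial k)
            * x ^ (k - 1) * Real.exp (-(k * x)) := by
  have h := shifted_prob (ℙ : Measure Ω) x hx n X hmeas hindep hdist ((1 + lam) * x)
    (mul_nonneg (by linarith) hx)
  have hset : {ω | ∀ k ∈ Finset.Icc 1 n, (∑ j ∈ Finset.range k, X j ω) / (k + lam) ≤ x}
      = {ω | ∀ k < n, ∑ j ∈ Finset.range (k+1), X j ω ≤ (1 + lam) * x + k * x} := by
    ext ω
    simp only [Set.mem_ofPred_eq]
    constructor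
    · intro h k hk
      have h1 := h (k+1) (by simp; omega)
      have hp : (0:ℝ) < ((k+1 : ℕ) : ℝ) + lam := by
        push_cast; have : (0:ℝ) ≤ k := by positivity
        linarith
      rw [div_le_iff₀ hp] at h1
      push_cast at h1
      linarith
    · intro h k hk
      obtain ⟨k, rfl⟩ : ∃ m, k = m + 1 := ⟨k - 1, by simp at hk; omega⟩
      have h1 := h k (by simp at hk; omega)
      have hp : (0:ℝ) < ((k+1 : ℕ) : ℝ) + lam := by
        push_cast; have : (0:ℝ) ≤ k := by positivity
        linarith
      rw [div_le_iff₀ hp]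
      push_cast
      linarith
  rw [hset, h, abelF]
  congr 1
  rw [← Finset.Ico_add_one_right_eq_Icc, Finset.sum_Ico_eq_sum_range, Finset.mul_sum]
  refine Finset.sum_congr (by simp) fun k _ => ?_
  have hl : (1 + lam) ≠ 0 := by linarith
  rw [show -((1 + lam) * x + k * x) = -(lam * x) + -(((1 + k : ℕ) : ℝ) * x) by push_cast; ring,
    Real.exp_add]
  cases k with
  | zero =>
    simp [abelP]
    field_simp
  | succ k =>
    have hz : (((1 + (k+1) : ℕ) : ℤ) - 2) = (k : ℤ) := by push_cast; ring
    rw [hz, zpow_natCast]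
    have hf : ((Nat.factorial (k+1) : ℕ) : ℝ) ≠ 0 := by positivity
    have hk : ((k : ℝ) + 1 + 1) ≠ 0 := by positivity
    have e1 : (1 + lam) * x + (k + 1) * x = (((1 + (k+1) : ℕ) : ℝ) + lam) * x := by
      push_cast; ring
    rw [show 1 + (k+1) - 1 = k + 1 by omega]
    simp only [abelP]
    rw [e1, mul_pow, show 1 + (k+1) = k+1+1 by omega, Nat.factorial_succ (k+1)]
    push_cast
    field_simp
    ring
end

section
/- Let (X_i)_{i≥1} be i.i.d. exponential random variables with mean 1 and, for λ > −1, let Z_{∞;λ} := sup{ (X_1 + ... + X_k)/(k + λ) : k ∈ ℕ⁺ }, with cumulative distribution function F_{∞;λ}. For x ≥ 1, let t(x) denote the unique t ∈ (0, 1] with t e^{−t} = x e^{−x}. Then for every x ≥ 1, F_{∞;λ}(x) = 1 − (t(x)/x) · e^{λ (t(x) − x)}. -/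
open MeasureTheory ProbabilityTheory Real

/-- Survival set for `n` steps, started at level `c`, with drift `x` per step. -/
def survSet (x : ℝ) : (n : ℕ) → ℝ → Set (Fin n → ℝ)
  | 0, _ => Set.univ
  | n + 1, c => {v | v 0 ≤ c + x ∧ (fun i : Fin n => v i.succ) ∈ survSet x n (c + x - v 0)}

lemma mem_survSet (x : ℝ) (n : ℕ) : ∀ (c : ℝ) (u : ℕ → ℝ),
    (fun i : Fin n => u i) ∈ survSet x n c ↔
      ∀ k : ℕ, 1 ≤ k → k ≤ n → ∑ j ∈ Finset.range k, u j ≤ c + k * x := by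
  induction n with
  | zero =>
    intro c u
    simp only [survSet, Set.mem_univ, true_iff]
    intro k h1 h2
    omega
  | succ n ih =>
    intro c u
    have h := ih (c + x - u 0) (fun j => u (j + 1))
    have h' : ((fun i : Fin (n + 1) => u i) ∈ survSet x (n + 1) c) ↔
        (u 0 ≤ c + x ∧ (fun i : Fin n => u (i + 1)) ∈ survSet x n (c + x - u 0)) := by
      simp [survSet]
    rw [h', h]
    constructor
    · rintro ⟨h0, hk⟩ k h1 h2
      obtain ⟨m, rfl⟩ : ∃ m, k = m + 1 := ⟨k - 1, by omega⟩
      rw [Finset.sum_range_succ']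
      rcases Nat.eq_zero_or_pos m with rfl | hm
      · simp; linarith
      · have := hk m hm (by omega)
        push_cast
        linarith
    · intro hk
      refine ⟨by simpa using hk 1 le_rfl (by omega), fun k h1 h2 => ?_⟩
      have := hk (k + 1) (by omega) (by omega)
      rw [Finset.sum_range_succ'] at this
      push_cast at this
      linarith

lemma measurable_survSet_joint (x : ℝ) (n : ℕ) :
    MeasurableSet {p : ℝ × (Fin n → ℝ) | p.2 ∈ survSet x n p.1} := by
  induction n with
  | zero => simp [survSet]
  | succ n ih =>
    have h1 : MeasurableSet {p : ℝ × (Fin (n + 1) → ℝ) | p.2 0 ≤ p.1 + x} :=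
      measurableSet_le (by fun_prop) (by fun_prop)
    have hf : Measurable (fun p : ℝ × (Fin (n + 1) → ℝ) =>
        (p.1 + x - p.2 0, fun i : Fin n => p.2 i.succ)) := by fun_prop
    exact h1.inter (hf ih)

lemma measurable_survSet (x : ℝ) (n : ℕ) (c : ℝ) : MeasurableSet (survSet x n c) := by
  have hf : Measurable (fun v : Fin n → ℝ => (c, v)) := by fun_prop
  exact hf (measurable_survSet_joint x n)

instance : IsProbabilityMeasure (expMeasure 1) := isProbabilityMeasure_expMeasure one_pos

/-- One-step recursion. -/
lemma survSet_rec (x : ℝ) (n : ℕ) (c : ℝ) :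
    Measure.pi (fun _ : Fin (n + 1) => expMeasure 1) (survSet x (n + 1) c) =
      ∫⁻ y in Set.Icc 0 (c + x), ENNReal.ofReal (rexp (-y)) *
        Measure.pi (fun _ : Fin n => expMeasure 1) (survSet x n (c + x - y)) := by
  have hmp := measurePreserving_piFinSuccAbove (fun _ : Fin (n + 1) => expMeasure 1) 0
  let B : Set (ℝ × (Fin n → ℝ)) := {p | p.1 ≤ c + x ∧ p.2 ∈ survSet x n (c + x - p.1)}
  have hB : MeasurableSet B := by
    have h1 : MeasurableSet {p : ℝ × (Fin n → ℝ) | p.1 ≤ c + x} :=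
      measurableSet_le (by fun_prop) (by fun_prop)
    have hf : Measurable (fun p : ℝ × (Fin n → ℝ) => (c + x - p.1, p.2)) := by fun_prop
    exact h1.inter (hf (measurable_survSet_joint x n))
  have hpre : survSet x (n + 1) c =
      (MeasurableEquiv.piFinSuccAbove (fun _ : Fin (n + 1) => ℝ) 0) ⁻¹' B := by
    ext v
    rfl
  rw [hpre, hmp.measure_preimage hB.nullMeasurableSet, Measure.prod_apply hB]
  have hexp : expMeasure 1 = volume.withDensity (exponentialPDF 1) := rfl
  have hmeas : Measurable (exponentialPDF 1) :=
    (measurable_exponentialPDFReal 1).ennreal_ofReal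
  have hg := measurable_measure_prodMk_left (ν := Measure.pi (fun _ : Fin n => expMeasure 1)) hB
  have key : ∀ (g : ℝ → ENNReal), Measurable g → ∫⁻ y, g y ∂(expMeasure 1) =
      ∫⁻ y, exponentialPDF 1 y * g y := by
    intro g hg
    rw [hexp, lintegral_withDensity_eq_lintegral_mul _ hmeas hg]
    rfl
  rw [key _ hg, ← lintegral_indicator measurableSet_Icc]
  apply lintegral_congr
  intro y
  by_cases hy : 0 ≤ y
  · by_cases hy2 : y ≤ c + x
    · rw [Set.indicator_of_mem (by exact ⟨hy, hy2⟩), exponentialPDF_of_nonneg hy]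
      have : Prod.mk y ⁻¹' B = survSet x n (c + x - y) := by
        ext v; simp [B, hy2]
      rw [this]; simp
    · rw [Set.indicator_of_notMem (by simp [hy2])]
      have : Prod.mk y ⁻¹' B = ∅ := by
        ext v; simp [B, hy2]
      rw [this]; simp
  · rw [Set.indicator_of_notMem (by simp [hy]), exponentialPDF_of_neg (not_le.1 hy), zero_mul]

lemma integral_single (L α : ℝ) (hα : α ≠ 1) :
    ∫ y in (0 : ℝ)..L, rexp (-y) * rexp (-α * (L - y)) =
      (rexp (-α * L) - rexp (-L)) / (1 - α) := by
  have h1 : (1 - α) ≠ 0 := fun h => hα (by linarith)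
  have hd : ∀ y ∈ Set.uIcc 0 L, HasDerivAt
      (fun y => -(rexp (-α * L + (-(1 - α)) * y)) / (1 - α))
      (rexp (-y) * rexp (-α * (L - y))) y := by
    intro y _
    have h := (((((hasDerivAt_id y).const_mul (-(1 - α))).const_add (-α * L)).exp).neg).div_const
      (1 - α)
    refine HasDerivAt.congr_deriv h ?_
    rw [← Real.exp_add]
    simp only [id]
    rw [show -y + -α * (L - y) = -α * L + -(1 - α) * y by ring]
    field_simp
  rw [intervalIntegral.integral_eq_sub_of_hasDerivAt hd (Continuous.intervalIntegrable (by fun_prop) _ _)]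
  rw [show -α * L + -(1 - α) * L = -L by ring]
  simp
  field_simp
  ring

lemma integral_G (L b d α β : ℝ) (hα : α ≠ 1) (hβ : β ≠ 1) :
    ∫ y in (0 : ℝ)..L, rexp (-y) * (1 + b * rexp (-α * (L - y)) + d * rexp (-β * (L - y))) =
      (1 - rexp (-L)) + b * ((rexp (-α * L) - rexp (-L)) / (1 - α))
        + d * ((rexp (-β * L) - rexp (-L)) / (1 - β)) := by
  have h0 := integral_single L 0 (by norm_num)
  rw [← integral_single L α hα, ← integral_single L β hβ]
  have h0' : (1 - rexp (-L)) = ∫ y in (0 : ℝ)..L, rexp (-y) := by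
    simp
  rw [h0', ← intervalIntegral.integral_const_mul, ← intervalIntegral.integral_const_mul,
    ← intervalIntegral.integral_add (Continuous.intervalIntegrable (by fun_prop) _ _)
      (Continuous.intervalIntegrable (by fun_prop) _ _),
    ← intervalIntegral.integral_add (Continuous.intervalIntegrable (by fun_prop) _ _)
      (Continuous.intervalIntegrable (by fun_prop) _ _)]
  congr 1
  ext y
  ring

lemma lint_G (L : ℝ) (hL : 0 ≤ L) (f : ℝ → ℝ) (hf : Continuous f)
    (hpos : ∀ y ∈ Set.Icc 0 L, 0 ≤ f y) :
    ∫⁻ y in Set.Icc 0 L, ENNReal.ofReal (rexp (-y)) * ENNReal.ofReal (f y) =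
      ENNReal.ofReal (∫ y in (0 : ℝ)..L, rexp (-y) * f y) := by
  rw [intervalIntegral.integral_of_le hL, ← integral_Icc_eq_integral_Ioc,
    ofReal_integral_eq_lintegral_ofReal]
  · apply lintegral_congr
    intro y
    rw [ENNReal.ofReal_mul (Real.exp_pos _).le]
  · exact (Continuous.continuousOn (by fun_prop)).integrableOn_compact isCompact_Icc
  · filter_upwards [ae_restrict_mem measurableSet_Icc] with y hy
    exact mul_nonneg (Real.exp_pos _).le (hpos y hy)

section bounds

variable {x t : ℝ}

lemma exp_rel (hx : 1 < x) (ht : 0 < t) (htx : t * rexp (-t) = x * rexp (-x)) :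
    rexp (-(1 - t / x) * x) = t / x := by
  have : -(1 - t / x) * x = t + -x := by field_simp; ring
  rw [this, Real.exp_add]
  have h : rexp (-t) * rexp t = 1 := by rw [← Real.exp_add]; simp
  field_simp
  calc rexp t * x * rexp (-x) = (x * rexp (-x)) * rexp t := by ring
    _ = t * (rexp (-t) * rexp t) := by rw [← htx]; ring
    _ = t := by rw [h, mul_one]

lemma h_nonneg (hx : 1 < x) (ht : 0 < t) (ht1 : t ≤ 1)
    (htx : t * rexp (-t) = x * rexp (-x)) (c : ℝ) (hc : -x ≤ c) :
    0 ≤ 1 + (-(t / x)) * rexp (-(1 - t / x) * c) := by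
  have hr := exp_rel hx ht htx
  have hθ : 0 ≤ 1 - t / x := by
    rw [sub_nonneg, div_le_one (by linarith)]; linarith
  have : rexp (-(1 - t / x) * x + -(1 - t / x) * c) ≤ 1 := by
    rw [Real.exp_le_one_iff]
    nlinarith
  rw [Real.exp_add, hr] at this
  linarith

lemma lower_bound (hx : 1 < x) (ht : 0 < t) (ht1 : t ≤ 1)
    (htx : t * rexp (-t) = x * rexp (-x)) (n : ℕ) : ∀ c : ℝ, -x ≤ c →
    ENNReal.ofReal (1 + (-(t / x)) * rexp (-(1 - t / x) * c)) ≤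
      Measure.pi (fun _ : Fin n => expMeasure 1) (survSet x n c) := by
  have hx0 : 0 < x := by linarith
  induction n with
  | zero =>
    intro c hc
    simp only [survSet, measure_univ]
    rw [ENNReal.ofReal_le_one]
    have : 0 ≤ t / x * rexp (-(1 - t / x) * c) := by positivity
    linarith
  | succ n ih =>
    intro c hc
    rw [survSet_rec]
    calc _ = ∫⁻ y in Set.Icc 0 (c + x), ENNReal.ofReal (rexp (-y)) *
          ENNReal.ofReal (1 + (-(t / x)) * rexp (-(1 - t / x) * (c + x - y))) := by
          rw [lint_G (c + x) (by linarith) _ (by fun_prop)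
            (fun y hy => h_nonneg hx ht ht1 htx _ (by linarith [hy.2]))]
          congr 1
          have h := integral_G (c + x) (-(t / x)) 0 (1 - t / x) 0
            (by have : 0 < t / x := by positivity
                linarith) (by norm_num)
          simp only [zero_mul, add_zero] at h
          rw [h]
          have h2 := exp_rel hx ht htx
          rw [mul_add, Real.exp_add, h2, sub_sub_cancel]
          have ht0 := ht.ne'
          generalize rexp (-(1 - t / x) * c) = E1
          generalize rexp (-(c + x)) = E2
          field_simp
          ring
      _ ≤ _ := by
          apply setLIntegral_mono' measurableSet_Icc
          intro y hy
          gcongr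
          exact ih _ (by linarith [hy.2])

lemma upper_bound (hx : 1 < x) (ht : 0 < t) (ht1 : t ≤ 1)
    (htx : t * rexp (-t) = x * rexp (-x)) : ∃ K : ℝ, 0 ≤ K ∧ ∀ (n : ℕ) (c : ℝ), -x ≤ c →
      Measure.pi (fun _ : Fin n => expMeasure 1) (survSet x n c) ≤
    ENNReal.ofReal (1 + (-(t / x)) * rexp (-(1 - t / x) * c)
      + (K * (x * rexp (1 - x)) ^ n) * rexp (-(1 - 1 / x) * c)) := by
  have hx0 : 0 < x := by linarith
  refine ⟨t / x * rexp (((1 - t / x) - (1 - 1 / x)) * x), by positivity, ?_⟩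
  set K := t / x * rexp (((1 - t / x) - (1 - 1 / x)) * x) with hK
  have hK0 : 0 ≤ K := by positivity
  intro n
  induction n with
  | zero =>
    intro c hc
    simp only [survSet, measure_univ]
    rw [ENNReal.one_le_ofReal, pow_zero, mul_one, hK, mul_assoc, ← Real.exp_add]
    have hle : rexp (-(1 - t / x) * c) ≤
        rexp ((1 - t / x - (1 - 1 / x)) * x + -(1 - 1 / x) * c) := by
      rw [Real.exp_le_exp]
      have : 0 ≤ (1 / x - t / x) := by
        rw [← sub_div]; apply div_nonneg <;> linarith
      nlinarith
    have : 0 < t / x := by positivity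
    nlinarith
  | succ n ih =>
    intro c hc
    rw [survSet_rec]
    set d := K * (x * rexp (1 - x)) ^ n with hd
    have hd0 : 0 ≤ d := by positivity
    calc _ ≤ ∫⁻ y in Set.Icc 0 (c + x), ENNReal.ofReal (rexp (-y)) *
          ENNReal.ofReal (1 + (-(t / x)) * rexp (-(1 - t / x) * (c + x - y))
            + d * rexp (-(1 - 1 / x) * (c + x - y))) := by
          apply setLIntegral_mono' measurableSet_Icc
          intro y hy
          gcongr
          exact ih _ (by linarith [hy.2])
      _ ≤ _ := by
          rw [lint_G (c + x) (by linarith) _ (by fun_prop)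
            (fun y hy => add_nonneg (h_nonneg hx ht ht1 htx _ (by linarith [hy.2]))
              (by positivity))]
          apply ENNReal.ofReal_le_ofReal
          rw [integral_G (c + x) (-(t / x)) d (1 - t / x) (1 - 1 / x)
            (by have : 0 < t / x := by positivity
                linarith) (by have : 0 < 1 / x := by positivity
                              linarith)]
          have h2 := exp_rel hx ht htx
          have h3 : rexp (-(1 - 1 / x) * x) = rexp (1 - x) := by
            congr 1; field_simp; ring
          have e1 : -(t / x) * ((rexp (-(1 - t / x) * (c + x)) - rexp (-(c + x))) / (1 - (1 - t / x)))
              = - (t / x * rexp (-(1 - t / x) * c)) + rexp (-(c + x)) := by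
            rw [mul_add (-(1 - t / x)), Real.exp_add, h2, sub_sub_cancel]
            have ht0 := ht.ne'
            generalize rexp (-(1 - t / x) * c) = E1
            generalize rexp (-(c + x)) = E2
            field_simp
            ring
          have e2 : d * ((rexp (-(1 - 1 / x) * (c + x)) - rexp (-(c + x))) / (1 - (1 - 1 / x)))
              = K * (x * rexp (1 - x)) ^ (n + 1) * rexp (-(1 - 1 / x) * c)
                - d * x * rexp (-(c + x)) := by
            rw [mul_add (-(1 - 1 / x)), Real.exp_add, h3, hd]
            field_simp
            ring
          rw [e1, e2]
          have : 0 ≤ d * x * rexp (-(c + x)) := by positivity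
          linarith

end bounds

lemma mul_exp_lt_one {x : ℝ} (hx : x ≠ 1) : x * rexp (1 - x) < 1 := by
  have h := Real.add_one_lt_exp (x := x - 1) (by intro h; exact hx (by linarith))
  have h2 : rexp (x - 1) * rexp (1 - x) = 1 := by rw [← Real.exp_add]; simp
  nlinarith [Real.exp_pos (1 - x)]

lemma mul_exp_neg_lt {x : ℝ} (hx : x ≠ 1) : x * rexp (-x) < 1 * rexp (-1) := by
  have h := mul_exp_lt_one hx
  rw [show 1 - x = 1 + -x by ring, Real.exp_add] at h
  have h2 : rexp (-1) * rexp 1 = 1 := by rw [← Real.exp_add]; simp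
  have := Real.exp_pos (-1)
  calc x * rexp (-x) = (x * (rexp 1 * rexp (-x))) * rexp (-1) := by
        linear_combination (-(x * rexp (-x))) * h2
    _ < 1 * rexp (-1) := by gcongr

lemma main_gt
    {Ω : Type*} [MeasureSpace Ω] [IsProbabilityMeasure (ℙ : Measure Ω)]
    (X : ℕ → Ω → ℝ) (hmeas : ∀ i, Measurable (X i))
    (hindep : iIndepFun X ℙ)
    (hdist : ∀ i, Measure.map (X i) ℙ = expMeasure 1)
    (lam : ℝ) (hlam : -1 < lam) (x : ℝ) (hx : 1 < x)
    (t : ℝ) (ht : t ∈ Set.Ioc (0 : ℝ) 1) (htx : t * Real.exp (-t) = x * Real.exp (-x)) :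
    (ℙ {ω | ∀ k : ℕ, 1 ≤ k →
        (∑ j ∈ Finset.range k, X j ω) / (k + lam) ≤ x}).toReal
      = 1 - t / x * Real.exp (lam * (t - x)) := by
  have hx0 : 0 < x := by linarith
  have hmapn : ∀ n : ℕ, Measurable (fun ω => fun i : Fin n => X i ω) := by
    intro n; fun_prop
  have hlaw : ∀ n : ℕ, Measure.map (fun ω => fun i : Fin n => X i ω) ℙ =
      Measure.pi (fun _ : Fin n => expMeasure 1) := by
    intro n
    have h := hindep.precomp (g := fun i : Fin n => (i : ℕ)) Fin.val_injective
    rw [iIndepFun_iff_map_fun_eq_pi_map (fun i => (hmeas _).aemeasurable)] at h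
    rw [h]
    simp only [hdist]
  let s : ℕ → Set Ω := fun n => (fun ω => fun i : Fin n => X i ω) ⁻¹' survSet x n (x * lam)
  have hs : ∀ n, MeasurableSet (s n) := fun n => hmapn n (measurable_survSet x n _)
  have hsmem : ∀ n ω, ω ∈ s n ↔ ∀ k : ℕ, 1 ≤ k → k ≤ n →
      (∑ j ∈ Finset.range k, X j ω) / (k + lam) ≤ x := by
    intro n ω
    refine (mem_survSet x n (x * lam) (fun j => X j ω)).trans ?_
    refine forall_congr' fun k => forall_congr' fun h1 => forall_congr' fun h2 => ?_
    have h1' : (1 : ℝ) ≤ k := by exact_mod_cast h1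
    rw [div_le_iff₀ (by linarith)]
    rw [show x * lam + k * x = x * (k + lam) by ring]
  have hinter : {ω | ∀ k : ℕ, 1 ≤ k →
        (∑ j ∈ Finset.range k, X j ω) / (k + lam) ≤ x} = ⋂ n, s n := by
    ext ω
    simp only [Set.mem_ofPred_eq, Set.mem_iInter, hsmem]
    exact ⟨fun h n k h1 _ => h k h1, fun h k h1 => h k k h1 le_rfl⟩
  have hanti : Antitone s := by
    intro m n hmn ω hω
    rw [hsmem] at hω ⊢
    exact fun k h1 h2 => hω k h1 (h2.trans hmn)
  have hlim := tendsto_measure_iInter_atTop (μ := (ℙ : Measure Ω))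
    (fun n => (hs n).nullMeasurableSet) hanti ⟨0, measure_ne_top _ _⟩
  have hval : ∀ n, (ℙ : Measure Ω) (s n) =
      Measure.pi (fun _ : Fin n => expMeasure 1) (survSet x n (x * lam)) := by
    intro n
    rw [← hlaw n, Measure.map_apply (hmapn n) (measurable_survSet x n _)]
  have hc : -x ≤ x * lam := by nlinarith
  obtain ⟨K, hK0, hK⟩ := upper_bound hx ht.1 ht.2 htx
  have hh := h_nonneg hx ht.1 ht.2 htx (x * lam) hc
  set h := 1 + (-(t / x)) * rexp (-(1 - t / x) * (x * lam)) with hdef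
  have hlim2 : Filter.Tendsto (ℙ ∘ s) Filter.atTop (nhds (ENNReal.ofReal h)) := by
    refine tendsto_of_tendsto_of_tendsto_of_le_of_le (g := fun _ => ENNReal.ofReal h)
      (h := fun n => ENNReal.ofReal (h + (K * (x * rexp (1 - x)) ^ n) *
        rexp (-(1 - 1 / x) * (x * lam)))) tendsto_const_nhds ?_ ?_ ?_
    · apply ENNReal.tendsto_ofReal
      have hp := tendsto_pow_atTop_nhds_zero_of_lt_one (r := x * rexp (1 - x)) (by positivity)
        (mul_exp_lt_one hx.ne')
      have := ((hp.const_mul K).mul_const (rexp (-(1 - 1 / x) * (x * lam)))).const_add h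
      simpa using this
    · intro n
      simp only [Function.comp, hval]
      exact lower_bound hx ht.1 ht.2 htx n _ hc
    · intro n
      simp only [Function.comp, hval]
      exact hK n _ hc
  rw [hinter, tendsto_nhds_unique hlim hlim2, ENNReal.toReal_ofReal hh, hdef]
  have : -(1 - t / x) * (x * lam) = lam * (t - x) := by field_simp; ring
  rw [this]; ring

/-- Solutions of the transcendental relation arbitrarily close to `1`. -/
lemma exists_pair (δ : ℝ) (hδ : 0 < δ) (hδ1 : δ < 1) :
    ∃ x t : ℝ, 1 < x ∧ x ≤ 1 + δ ∧ 1 - δ ≤ t ∧ t ≤ 1 ∧ t * rexp (-t) = x * rexp (-x) := by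
  have hcont : Continuous (fun s : ℝ => s * rexp (-s)) := by fun_prop
  rcases le_total ((1 - δ) * rexp (-(1 - δ))) ((1 + δ) * rexp (-(1 + δ))) with h | h
  · obtain ⟨t, ht, hte⟩ := intermediate_value_Icc (a := 1 - δ) (b := 1) (by linarith)
      hcont.continuousOn ⟨h, (mul_exp_neg_lt (x := 1 + δ) (by linarith)).le⟩
    exact ⟨1 + δ, t, by linarith, le_rfl, ht.1, ht.2, hte⟩
  · have hlt := mul_exp_neg_lt (x := 1 - δ) (by linarith)
    obtain ⟨x, hx, hxe⟩ := intermediate_value_Icc' (a := 1) (b := 1 + δ) (by linarith)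
      hcont.continuousOn ⟨h, hlt.le⟩
    refine ⟨x, 1 - δ, lt_of_le_of_ne hx.1 ?_, hx.2, le_rfl, by linarith, hxe.symm⟩
    rintro rfl
    exact hlt.ne hxe.symm

/-- If `(X i)` are i.i.d. exponential random variables with mean 1, `lam > -1`,
`Z_{∞;lam} = sup{(X_1 + ⋯ + X_k)/(k + lam) : k ≥ 1}` with CDF `F_{∞;lam}`, and for
`x ≥ 1`, `t ∈ (0, 1]` is the value with `t e^{-t} = x e^{-x}`, then
`F_{∞;lam}(x) = 1 - (t/x) e^{lam (t - x)}`. -/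
theorem shiftedSup_cdf_exponential
    {Ω : Type*} [MeasureSpace Ω] [IsProbabilityMeasure (ℙ : Measure Ω)]
    (X : ℕ → Ω → ℝ) (hmeas : ∀ i, Measurable (X i))
    (hindep : iIndepFun X ℙ)
    (hdist : ∀ i, Measure.map (X i) ℙ = expMeasure 1)
    (lam : ℝ) (hlam : -1 < lam) (x : ℝ) (hx : 1 ≤ x)
    (t : ℝ) (ht : t ∈ Set.Ioc (0 : ℝ) 1) (htx : t * Real.exp (-t) = x * Real.exp (-x)) :
    (ℙ {ω | ∀ k : ℕ, 1 ≤ k →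
        (∑ j ∈ Finset.range k, X j ω) / (k + lam) ≤ x}).toReal
      = 1 - t / x * Real.exp (lam * (t - x)) := by
  rcases hx.lt_or_eq with hx | rfl
  · exact main_gt X hmeas hindep hdist lam hlam x hx t ht htx
  have ht1 : t = 1 := by
    by_contra hne
    exact (mul_exp_neg_lt hne).ne htx
  subst ht1
  have hrhs : (1 : ℝ) - 1 / 1 * rexp (lam * (1 - 1)) = 0 := by simp
  rw [hrhs]
  apply le_antisymm _ ENNReal.toReal_nonneg
  apply le_of_forall_pos_le_add
  intro ε hε
  have hcont : ContinuousAt (fun p : ℝ × ℝ => 1 - p.2 / p.1 * rexp (lam * (p.2 - p.1)))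
      ((1, 1) : ℝ × ℝ) := by
    have : ((1, 1) : ℝ × ℝ).1 ≠ 0 := by norm_num
    fun_prop (disch := assumption)
  obtain ⟨δ, hδ, hδε⟩ := Metric.continuousAt_iff.1 hcont ε hε
  obtain ⟨x, t, hx1, hx2, ht1, ht2, he⟩ := exists_pair (min (δ / 2) (1 / 2)) (by positivity)
    (lt_of_le_of_lt (min_le_right _ _) (by norm_num))
  have hm1 := min_le_left (δ / 2) (1 / 2)
  have hm2 := min_le_right (δ / 2) (1 / 2)
  have hd := @hδε (x, t) (by
    rw [Prod.dist_eq, max_lt_iff, Real.dist_eq, Real.dist_eq, abs_lt, abs_lt]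
    simp only
    refine ⟨⟨?_, ?_⟩, ?_, ?_⟩ <;> linarith)
  simp only [Real.dist_eq, hrhs, sub_zero] at hd
  have hmain := main_gt X hmeas hindep hdist lam hlam x hx1 t ⟨by linarith, ht2⟩ he
  rw [← hmain] at hd
  rw [zero_add]
  refine le_trans ?_ (le_trans (le_abs_self _) hd.le)
  apply ENNReal.toReal_mono (measure_ne_top _ _)
  apply measure_mono
  intro ω hω k hk
  exact (hω k hk).trans hx1.le
end
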